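/- arXiv:1606.02291 — 3 statements merged into one kernel-verified Lean document; each statement's English description precedes it below -/
import Mathlib

section
/- Let μ : Fin n → ℕ be a partition and α : Fin n → ℕ a weak composition. Let u ∈ S_n be a permutation of minimal length among those for which α ∘ u is weakly decreasing, and let w be a reduced word for u⁻¹, so that θ_w(x^{α∘u}) is the Demazure atom A_α. Then the product x^μ * θ_w(x^{α∘u}) (i.e. A_μ · A_α, the product of a dominating monomial and a Demazure atom) is atom-positive. -/
open MvPolynomial

noncomputable section

/-- Valid indices: `i` with `i + 1 < n`. -/
abbrev Idx (n : ℕ) := {i : ℕ // i + 1 < n}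

/-- The element `i` of `Fin n`. -/
def idxLow {n : ℕ} (i : Idx n) : Fin n := ⟨i.1, Nat.lt_of_succ_lt i.2⟩

/-- The element `i + 1` of `Fin n`. -/
def idxHigh {n : ℕ} (i : Idx n) : Fin n := ⟨i.1 + 1, i.2⟩

/-- The simple transposition `s_i = (i, i+1)` in `S_n`. -/
def simpleT {n : ℕ} (i : Idx n) : Equiv.Perm (Fin n) := Equiv.swap (idxLow i) (idxHigh i)

/-- The action of `s_i` on polynomials, renaming the variables `X i` and `X (i+1)`. -/
def sOp {n : ℕ} (i : Idx n) (f : MvPolynomial (Fin n) ℤ) : MvPolynomial (Fin n) ℤ :=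
  rename ⇑(simpleT i) f

/-- The type of families of operators indexed by valid indices. -/
abbrev DD (n : ℕ) := Idx n → MvPolynomial (Fin n) ℤ → MvPolynomial (Fin n) ℤ

/-- `D` is the family of divided difference operators `∂_i`:
`(X i − X (i+1)) * ∂_i f = f − s_i f` (this determines `∂_i f` uniquely since
`MvPolynomial (Fin n) ℤ` is an integral domain). -/
def IsDividedDiff {n : ℕ} (D : DD n) : Prop :=
  ∀ (i : Idx n) (f : MvPolynomial (Fin n) ℤ),
    (X (idxLow i) - X (idxHigh i)) * D i f = f - sOp i f

/-- `π_i f = ∂_i (X i * f)`. -/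
def piOp {n : ℕ} (D : DD n) (i : Idx n) (f : MvPolynomial (Fin n) ℤ) :
    MvPolynomial (Fin n) ℤ :=
  D i (X (idxLow i) * f)

/-- `θ_i f = X (i+1) * ∂_i f`. -/
def thetaOp {n : ℕ} (D : DD n) (i : Idx n) (f : MvPolynomial (Fin n) ℤ) :
    MvPolynomial (Fin n) ℤ :=
  X (idxHigh i) * D i f

/-- `θ_w = θ_{i_1} ∘ ⋯ ∘ θ_{i_k}` for a word `w = (i_1, …, i_k)`. -/
def thetaWord {n : ℕ} (D : DD n) : List (Idx n) → MvPolynomial (Fin n) ℤ → MvPolynomial (Fin n) ℤ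
  | [], f => f
  | i :: w, f => thetaOp D i (thetaWord D w f)

/-- `π_w = π_{i_1} ∘ ⋯ ∘ π_{i_k}` for a word `w = (i_1, …, i_k)`. -/
def piWord {n : ℕ} (D : DD n) : List (Idx n) → MvPolynomial (Fin n) ℤ → MvPolynomial (Fin n) ℤ
  | [], f => f
  | i :: w, f => piOp D i (piWord D w f)

/-- The permutation `s_{i_1} · ⋯ · s_{i_k}` represented by a word. -/
def wordProd {n : ℕ} (w : List (Idx n)) : Equiv.Perm (Fin n) := (w.map simpleT).prod

/-- `w` is a reduced word for `σ`: it represents `σ` and no shorter word does. -/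
def IsReducedWord {n : ℕ} (w : List (Idx n)) (σ : Equiv.Perm (Fin n)) : Prop :=
  wordProd w = σ ∧ ∀ w' : List (Idx n), wordProd w' = σ → w.length ≤ w'.length

/-- The length `l(σ)`: the length of any reduced word for `σ`. -/
def len {n : ℕ} (σ : Equiv.Perm (Fin n)) : ℕ :=
  sInf {k | ∃ w : List (Idx n), wordProd w = σ ∧ w.length = k}

/-- Strong Bruhat order: some reduced word of `γ` is a (not necessarily contiguous)
subword of some reduced word of `σ`. -/
def BruhatLE {n : ℕ} (γ σ : Equiv.Perm (Fin n)) : Prop :=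
  ∃ u v : List (Idx n), IsReducedWord u γ ∧ IsReducedWord v σ ∧ u.Sublist v

/-- The monomial `x^λ = ∏ j, (X j)^(λ j)`. -/
def xpow {n : ℕ} (lam : Fin n → ℕ) : MvPolynomial (Fin n) ℤ := ∏ j, X j ^ lam j

/-- `f` is atom-positive: it lies in the additive submonoid generated by the
Demazure atoms `θ_w (x^λ)` with `w` a reduced word and `λ` a partition. -/
def AtomPos {n : ℕ} (D : DD n) (f : MvPolynomial (Fin n) ℤ) : Prop :=
  f ∈ AddSubmonoid.closure {g : MvPolynomial (Fin n) ℤ |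
    ∃ (w : List (Idx n)) (σ : Equiv.Perm (Fin n)) (lam : Fin n → ℕ),
      IsReducedWord w σ ∧ Antitone lam ∧ g = thetaWord D w (xpow lam)}

/-- `f` is key-positive: it lies in the additive submonoid generated by the
key polynomials `π_w (x^λ)` with `w` a word and `λ` a partition. -/
def KeyPos {n : ℕ} (D : DD n) (f : MvPolynomial (Fin n) ℤ) : Prop :=
  f ∈ AddSubmonoid.closure {g : MvPolynomial (Fin n) ℤ |
    ∃ (w : List (Idx n)) (lam : Fin n → ℕ),
      Antitone lam ∧ g = piWord D w (xpow lam)}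

/-- The number of inversions of a permutation. -/
def invNum {n : ℕ} (σ : Equiv.Perm (Fin n)) : ℕ :=
  (Finset.univ.filter (fun p : Fin n × Fin n => p.1 < p.2 ∧ σ p.2 < σ p.1)).card

end

lemma simpleT_apply {n : ℕ} (i : Idx n) (x : Fin n) :
    simpleT i x = if x = idxLow i then idxHigh i else if x = idxHigh i then idxLow i else x :=
  Equiv.swap_apply_def _ _ _

lemma simpleT_val {n : ℕ} (i : Idx n) (x : Fin n) :
    (simpleT i x : ℕ) = if (x : ℕ) = i.1 then i.1 + 1 else if (x : ℕ) = i.1 + 1 then i.1 else x := by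
  rw [simpleT_apply]
  simp only [Fin.ext_iff, idxLow, idxHigh]
  split_ifs <;> rfl

lemma simpleT_mul_self {n : ℕ} (i : Idx n) : simpleT i * simpleT i = 1 :=
  Equiv.swap_mul_self _ _

lemma simpleT_inv {n : ℕ} (i : Idx n) : (simpleT i)⁻¹ = simpleT i := Equiv.swap_inv _ _

@[simp] lemma simpleT_simpleT {n : ℕ} (i : Idx n) (x : Fin n) : simpleT i (simpleT i x) = x :=
  Equiv.Perm.congr_fun (simpleT_mul_self i) x

@[simp] lemma simpleT_low {n : ℕ} (i : Idx n) : simpleT i (idxLow i) = idxHigh i :=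
  Equiv.swap_apply_left _ _

@[simp] lemma simpleT_high {n : ℕ} (i : Idx n) : simpleT i (idxHigh i) = idxLow i :=
  Equiv.swap_apply_right _ _

lemma idxLow_lt_idxHigh {n : ℕ} (i : Idx n) : idxLow i < idxHigh i :=
  Fin.mk_lt_mk.2 (Nat.lt_succ_self _)

lemma simpleT_comm {n : ℕ} {i j : Idx n} (h : i.1 + 1 < j.1) :
    simpleT i * simpleT j = simpleT j * simpleT i := by
  ext x
  simp only [Equiv.Perm.mul_apply, simpleT_val]
  grind

lemma simpleT_braid {n : ℕ} {i j : Idx n} (h : j.1 = i.1 + 1) :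
    simpleT i * simpleT j * simpleT i = simpleT j * simpleT i * simpleT j := by
  ext x
  simp only [Equiv.Perm.mul_apply, simpleT_val, h]
  grind

/-- A simple transposition preserves the order of every pair other than the one it exchanges. -/
lemma simpleT_lt {n : ℕ} (i : Idx n) {x y : Fin n} (h : x < y)
    (hne : ¬ (x = idxLow i ∧ y = idxHigh i)) : simpleT i x < simpleT i y := by
  simp only [Fin.ext_iff, idxLow, idxHigh, Fin.lt_def, simpleT_val] at *
  split_ifs <;> omega

lemma invNum_mul_simpleT {n : ℕ} (σ : Equiv.Perm (Fin n)) (i : Idx n)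
    (h : σ (idxLow i) < σ (idxHigh i)) : invNum (σ * simpleT i) = invNum σ + 1 := by
  have hset : (Finset.univ.filter (fun p : Fin n × Fin n =>
        p.1 < p.2 ∧ (σ * simpleT i) p.2 < (σ * simpleT i) p.1)) =
      insert (idxLow i, idxHigh i)
        ((Finset.univ.filter (fun p : Fin n × Fin n => p.1 < p.2 ∧ σ p.2 < σ p.1)).map
          ((simpleT i).prodCongr (simpleT i)).toEmbedding) := by
    ext ⟨x, y⟩
    rw [Finset.mem_filter_univ]
    simp only [Finset.mem_filter_univ, Finset.mem_insert, Finset.mem_map, Prod.exists,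
      Equiv.coe_toEmbedding, Equiv.prodCongr_apply, Prod.map_apply, Prod.mk.injEq,
      Equiv.Perm.mul_apply]
    constructor
    · rintro ⟨hxy, hσ⟩
      by_cases hp : x = idxLow i ∧ y = idxHigh i
      · exact Or.inl hp
      · exact Or.inr ⟨simpleT i x, simpleT i y, ⟨simpleT_lt i hxy hp, hσ⟩, by simp, by simp⟩
    · rintro (⟨rfl, rfl⟩ | ⟨a, b, ⟨hab, hσ⟩, rfl, rfl⟩)
      · simpa [idxLow_lt_idxHigh] using h
      · refine ⟨simpleT_lt i hab ?_, by simpa using hσ⟩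
        rintro ⟨rfl, rfl⟩
        exact absurd h hσ.asymm
  unfold invNum
  rw [hset, Finset.card_insert_of_notMem, Finset.card_map]
  simp only [Finset.mem_map, Finset.mem_filter, Finset.mem_univ, true_and, Prod.exists,
    Equiv.coe_toEmbedding, Equiv.prodCongr_apply, Prod.map_apply, Prod.mk.injEq, not_exists]
  rintro a b ⟨⟨hab, -⟩, ha, hb⟩
  rw [← simpleT_high, (simpleT i).injective.eq_iff] at ha
  rw [← simpleT_low, (simpleT i).injective.eq_iff] at hb
  subst ha hb
  exact absurd hab (idxLow_lt_idxHigh i).asymm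

lemma invNum_mul_simpleT_of_gt {n : ℕ} (σ : Equiv.Perm (Fin n)) (i : Idx n)
    (h : σ (idxHigh i) < σ (idxLow i)) : invNum (σ * simpleT i) + 1 = invNum σ := by
  rw [← invNum_mul_simpleT (σ * simpleT i) i (by simpa using h), mul_assoc, simpleT_mul_self,
    mul_one]

lemma invNum_inv {n : ℕ} (σ : Equiv.Perm (Fin n)) : invNum σ⁻¹ = invNum σ := by
  unfold invNum
  refine Finset.card_bij' (fun p _ => (σ⁻¹ p.2, σ⁻¹ p.1)) (fun p _ => (σ p.2, σ p.1)) ?_ ?_ ?_ ?_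
  all_goals simp +contextual

lemma simpleT_mul_inv {n : ℕ} (σ : Equiv.Perm (Fin n)) (i : Idx n) :
    (simpleT i * σ)⁻¹ = σ⁻¹ * simpleT i := by
  rw [mul_inv_rev, simpleT_inv]

lemma invNum_simpleT_mul {n : ℕ} (σ : Equiv.Perm (Fin n)) (i : Idx n)
    (h : σ⁻¹ (idxLow i) < σ⁻¹ (idxHigh i)) : invNum (simpleT i * σ) = invNum σ + 1 := by
  rw [← invNum_inv, simpleT_mul_inv, invNum_mul_simpleT _ _ h, invNum_inv]

lemma invNum_simpleT_mul_of_gt {n : ℕ} (σ : Equiv.Perm (Fin n)) (i : Idx n)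
    (h : σ⁻¹ (idxHigh i) < σ⁻¹ (idxLow i)) : invNum (simpleT i * σ) + 1 = invNum σ := by
  rw [← invNum_inv, simpleT_mul_inv, invNum_mul_simpleT_of_gt _ _ h, invNum_inv]

lemma perm_low_lt_or_gt {n : ℕ} (σ : Equiv.Perm (Fin n)) (i : Idx n) :
    σ (idxLow i) < σ (idxHigh i) ∨ σ (idxHigh i) < σ (idxLow i) :=
  lt_or_gt_of_ne fun h => (idxLow_lt_idxHigh i).ne (σ.injective h)

lemma invNum_one {n : ℕ} : invNum (1 : Equiv.Perm (Fin n)) = 0 := by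
  exact Finset.card_eq_zero.2 (Finset.filter_eq_empty_iff.2 fun _ _ h => h.1.asymm h.2)

lemma wordProd_nil {n : ℕ} : wordProd ([] : List (Idx n)) = 1 := rfl

lemma wordProd_cons {n : ℕ} (i : Idx n) (w : List (Idx n)) :
    wordProd (i :: w) = simpleT i * wordProd w := by
  simp [wordProd]

lemma wordProd_append {n : ℕ} (v w : List (Idx n)) :
    wordProd (v ++ w) = wordProd v * wordProd w := by
  simp [wordProd]

lemma wordProd_concat {n : ℕ} (w : List (Idx n)) (i : Idx n) :
    wordProd (w ++ [i]) = wordProd w * simpleT i := by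
  simp [wordProd]

lemma invNum_wordProd_le {n : ℕ} (w : List (Idx n)) : invNum (wordProd w) ≤ w.length := by
  induction w with
  | nil => simp [wordProd_nil, invNum_one]
  | cons i w ih =>
    rw [wordProd_cons, List.length_cons]
    rcases perm_low_lt_or_gt (wordProd w)⁻¹ i with h | h
    · have := invNum_simpleT_mul _ i h
      omega
    · have := invNum_simpleT_mul_of_gt _ i h
      omega

/-- A function on `Fin n` that increases at each step of an interval is monotone there. -/
lemma le_of_forall_idx_le {n : ℕ} {β : Type*} [Preorder β] (f : Fin n → β) {a b : Fin n}
    (hab : a ≤ b)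
    (h : ∀ i : Idx n, a ≤ idxLow i → idxHigh i ≤ b → f (idxLow i) ≤ f (idxHigh i)) :
    f a ≤ f b := by
  obtain ⟨a, ha⟩ := a
  obtain ⟨b, hb⟩ := b
  replace hab : a ≤ b := hab
  induction b, hab using Nat.le_induction with
  | base => exact le_rfl
  | succ b hab ih =>
    refine (ih (by omega) fun i h1 h2 => h i h1 (h2.trans (Nat.le_succ b))).trans ?_
    exact h ⟨b, hb⟩ hab le_rfl

lemma monotone_of_forall_idx_le {n : ℕ} {β : Type*} [Preorder β] (f : Fin n → β)
    (h : ∀ i : Idx n, f (idxLow i) ≤ f (idxHigh i)) : Monotone f :=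
  fun _ _ hab => le_of_forall_idx_le f hab fun i _ _ => h i

lemma antitone_of_forall_idx_le {n : ℕ} {β : Type*} [Preorder β] (f : Fin n → β)
    (h : ∀ i : Idx n, f (idxHigh i) ≤ f (idxLow i)) : Antitone f :=
  monotone_of_forall_idx_le (β := βᵒᵈ) f h

lemma perm_eq_one_of_forall_idx_lt {n : ℕ} (σ : Equiv.Perm (Fin n))
    (h : ∀ i : Idx n, σ (idxLow i) < σ (idxHigh i)) : σ = 1 := by
  have hm : StrictMono σ :=
    (monotone_of_forall_idx_le σ fun i => (h i).le).strictMono_of_injective σ.injective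
  have := Subsingleton.elim (hm.orderIsoOfSurjective σ σ.surjective) (OrderIso.refl _)
  exact Equiv.ext fun x => DFunLike.congr_fun this x

lemma exists_word_length_eq_invNum {n : ℕ} (σ : Equiv.Perm (Fin n)) :
    ∃ w : List (Idx n), wordProd w = σ ∧ w.length = invNum σ := by
  induction hN : invNum σ using Nat.strong_induction_on generalizing σ with
  | _ N ih =>
    by_cases h : ∀ i : Idx n, σ (idxLow i) < σ (idxHigh i)
    · obtain rfl := perm_eq_one_of_forall_idx_lt σ h
      exact ⟨[], rfl, by rw [← hN, invNum_one]; rfl⟩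
    · push Not at h
      obtain ⟨i, hi⟩ := h
      have hlen := invNum_mul_simpleT_of_gt σ i
        ((perm_low_lt_or_gt σ i).resolve_left hi.not_gt)
      obtain ⟨w, hw, hl⟩ := ih _ (by omega) (σ * simpleT i) rfl
      refine ⟨w ++ [i], ?_, ?_⟩
      · rw [wordProd_concat, hw, mul_assoc, simpleT_mul_self, mul_one]
      · rw [List.length_append, List.length_singleton]
        omega

/-- A word whose length is the number of inversions of its product. -/
def IsTight {n : ℕ} (w : List (Idx n)) : Prop := w.length = invNum (wordProd w)

lemma isReducedWord_iff {n : ℕ} (w : List (Idx n)) (σ : Equiv.Perm (Fin n)) :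
    IsReducedWord w σ ↔ wordProd w = σ ∧ IsTight w := by
  constructor
  · rintro ⟨rfl, h⟩
    obtain ⟨v, hv, hl⟩ := exists_word_length_eq_invNum (wordProd w)
    exact ⟨rfl, le_antisymm (hl ▸ h v hv) (invNum_wordProd_le w)⟩
  · rintro ⟨rfl, h⟩
    refine ⟨rfl, fun v hv => ?_⟩
    rw [h, ← hv]
    exact invNum_wordProd_le v

lemma exists_isTight {n : ℕ} (σ : Equiv.Perm (Fin n)) :
    ∃ w : List (Idx n), wordProd w = σ ∧ IsTight w := by
  obtain ⟨w, rfl, hl⟩ := exists_word_length_eq_invNum σ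
  exact ⟨w, rfl, hl⟩

lemma isTight_cons_iff {n : ℕ} (i : Idx n) (w : List (Idx n)) :
    IsTight (i :: w) ↔
      IsTight w ∧ (wordProd w)⁻¹ (idxLow i) < (wordProd w)⁻¹ (idxHigh i) := by
  have hle := invNum_wordProd_le w
  unfold IsTight
  rw [wordProd_cons, List.length_cons]
  rcases perm_low_lt_or_gt (wordProd w)⁻¹ i with h | h
  · have := invNum_simpleT_mul _ i h
    simp only [h, and_true]
    omega
  · have := invNum_simpleT_mul_of_gt _ i h
    simp only [h.asymm, and_false, iff_false]
    omega

lemma isTight_concat_iff {n : ℕ} (w : List (Idx n)) (i : Idx n) :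
    IsTight (w ++ [i]) ↔ IsTight w ∧ wordProd w (idxLow i) < wordProd w (idxHigh i) := by
  have hle := invNum_wordProd_le w
  unfold IsTight
  rw [wordProd_concat, List.length_append, List.length_singleton]
  rcases perm_low_lt_or_gt (wordProd w) i with h | h
  · have := invNum_mul_simpleT _ i h
    simp only [h, and_true]
    omega
  · have := invNum_mul_simpleT_of_gt _ i h
    simp only [h.asymm, and_false, iff_false]
    omega

lemma IsTight.of_append_left {n : ℕ} {v w : List (Idx n)} (h : IsTight (v ++ w)) :
    IsTight v := by
  induction w using List.reverseRecOn with
  | nil => simpa using h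
  | append_singleton w i ih =>
    rw [← List.append_assoc, isTight_concat_iff] at h
    exact ih h.1

lemma IsTight.of_append_right {n : ℕ} {v w : List (Idx n)} (h : IsTight (v ++ w)) :
    IsTight w := by
  induction v with
  | nil => simpa using h
  | cons i v ih => exact ih ((isTight_cons_iff i (v ++ w)).1 h).1

/-- A left descent of a permutation is the first letter of some tight word. -/
lemma exists_isTight_cons {n : ℕ} (σ : Equiv.Perm (Fin n)) (i : Idx n)
    (h : σ⁻¹ (idxHigh i) < σ⁻¹ (idxLow i)) :
    ∃ w : List (Idx n), wordProd (i :: w) = σ ∧ IsTight (i :: w) := by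
  obtain ⟨w, hw, ht⟩ := exists_isTight (simpleT i * σ)
  refine ⟨w, ?_, (isTight_cons_iff i w).2 ⟨ht, ?_⟩⟩
  · rw [wordProd_cons, hw, ← mul_assoc, simpleT_mul_self, one_mul]
  · rw [hw, simpleT_mul_inv]
    simpa using h

/-- A right descent of a permutation is the last letter of some tight word. -/
lemma exists_isTight_concat {n : ℕ} (σ : Equiv.Perm (Fin n)) (i : Idx n)
    (h : σ (idxHigh i) < σ (idxLow i)) :
    ∃ w : List (Idx n), wordProd (w ++ [i]) = σ ∧ IsTight (w ++ [i]) := by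
  obtain ⟨w, hw, ht⟩ := exists_isTight (σ * simpleT i)
  refine ⟨w, ?_, (isTight_concat_iff w i).2 ⟨ht, ?_⟩⟩
  · rw [wordProd_concat, hw, mul_assoc, simpleT_mul_self, mul_one]
  · rw [hw]
    simpa using h

lemma IsTight.inv_gt {n : ℕ} {i : Idx n} {w : List (Idx n)} (h : IsTight (i :: w)) :
    (wordProd (i :: w))⁻¹ (idxHigh i) < (wordProd (i :: w))⁻¹ (idxLow i) := by
  rw [wordProd_cons, simpleT_mul_inv]
  simpa using ((isTight_cons_iff i w).1 h).2

lemma sOp_X {n : ℕ} (i : Idx n) (j : Fin n) : sOp i (X j) = X (simpleT i j) := rename_X _ _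

lemma sOp_mul {n : ℕ} (i : Idx n) (f g : MvPolynomial (Fin n) ℤ) :
    sOp i (f * g) = sOp i f * sOp i g := map_mul _ _ _

lemma sOp_add {n : ℕ} (i : Idx n) (f g : MvPolynomial (Fin n) ℤ) :
    sOp i (f + g) = sOp i f + sOp i g := map_add _ _ _

lemma sOp_sub {n : ℕ} (i : Idx n) (f g : MvPolynomial (Fin n) ℤ) :
    sOp i (f - g) = sOp i f - sOp i g := map_sub _ _ _

lemma sOp_sOp {n : ℕ} (i j : Idx n) (f : MvPolynomial (Fin n) ℤ) :
    sOp i (sOp j f) = rename (simpleT i * simpleT j) f := by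
  rw [sOp, sOp, rename_rename, Equiv.Perm.coe_mul]

lemma sOp_self {n : ℕ} (i : Idx n) (f : MvPolynomial (Fin n) ℤ) : sOp i (sOp i f) = f := by
  rw [sOp_sOp, simpleT_mul_self, Equiv.Perm.coe_one, rename_id_apply]

lemma sOp_comm {n : ℕ} {i j : Idx n} (h : i.1 + 1 < j.1) (f : MvPolynomial (Fin n) ℤ) :
    sOp i (sOp j f) = sOp j (sOp i f) := by
  rw [sOp_sOp, sOp_sOp, simpleT_comm h]

lemma sOp_braid {n : ℕ} {i j : Idx n} (h : j.1 = i.1 + 1) (f : MvPolynomial (Fin n) ℤ) :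
    sOp i (sOp j (sOp i f)) = sOp j (sOp i (sOp j f)) := by
  rw [sOp_sOp j i, sOp_sOp i j]
  unfold sOp
  rw [rename_rename, rename_rename, ← Equiv.Perm.coe_mul, ← Equiv.Perm.coe_mul, ← mul_assoc,
    ← mul_assoc, simpleT_braid h]

lemma sOp_xpow {n : ℕ} (i : Idx n) (lam : Fin n → ℕ) :
    sOp i (xpow lam) = xpow (lam ∘ simpleT i) := by
  rw [sOp, xpow, map_prod, xpow]
  refine Fintype.prod_equiv (simpleT i) _ _ fun j => ?_
  simp

lemma xpow_add {n : ℕ} (lam mu : Fin n → ℕ) : xpow (lam + mu) = xpow lam * xpow mu := by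
  simp only [xpow, Pi.add_apply, pow_add, Finset.prod_mul_distrib]

lemma X_low_sub_X_high_ne_zero {n : ℕ} (i : Idx n) :
    (X (idxLow i) - X (idxHigh i) : MvPolynomial (Fin n) ℤ) ≠ 0 :=
  sub_ne_zero.2 fun h => (idxLow_lt_idxHigh i).ne (X_injective h)

/-- The embedding of the polynomial ring in its field of fractions. -/
noncomputable def toFrac (n : ℕ) :
    MvPolynomial (Fin n) ℤ →+* FractionRing (MvPolynomial (Fin n) ℤ) :=
  algebraMap _ _

lemma toFrac_injective (n : ℕ) : Function.Injective (toFrac n) := IsFractionRing.injective _ _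

lemma toFrac_X_sub_ne_zero {n : ℕ} {x y : Fin n} (h : x ≠ y) :
    toFrac n (X x) - toFrac n (X y) ≠ 0 :=
  sub_ne_zero.2 fun e => h (X_injective (toFrac_injective n e))

namespace IsDividedDiff

variable {n : ℕ} {D : DD n}

lemma eq_of_mul_eq (hD : IsDividedDiff D) {i : Idx n} {f g : MvPolynomial (Fin n) ℤ}
    (h : (X (idxLow i) - X (idxHigh i)) * g = f - sOp i f) : D i f = g :=
  mul_left_cancel₀ (X_low_sub_X_high_ne_zero i) ((hD i f).trans h.symm)

lemma thetaOp_mul (hD : IsDividedDiff D) (i : Idx n) (f : MvPolynomial (Fin n) ℤ) :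
    (X (idxLow i) - X (idxHigh i)) * thetaOp D i f = X (idxHigh i) * (f - sOp i f) := by
  rw [thetaOp, ← hD i f]
  ring

lemma map_add (hD : IsDividedDiff D) (i : Idx n) (f g : MvPolynomial (Fin n) ℤ) :
    D i (f + g) = D i f + D i g :=
  hD.eq_of_mul_eq (by rw [mul_add, hD, hD, sOp_add]; ring)

lemma map_symm_mul (hD : IsDividedDiff D) (i : Idx n) {p : MvPolynomial (Fin n) ℤ}
    (hp : sOp i p = p) (f : MvPolynomial (Fin n) ℤ) : D i (p * f) = p * D i f :=
  hD.eq_of_mul_eq (by rw [mul_left_comm, hD, sOp_mul, hp, mul_sub])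

lemma map_symm (hD : IsDividedDiff D) (i : Idx n) {p : MvPolynomial (Fin n) ℤ}
    (hp : sOp i p = p) : D i p = 0 :=
  hD.eq_of_mul_eq (by rw [hp, mul_zero, sub_self])

lemma thetaOp_add (hD : IsDividedDiff D) (i : Idx n) (f g : MvPolynomial (Fin n) ℤ) :
    thetaOp D i (f + g) = thetaOp D i f + thetaOp D i g := by
  rw [thetaOp, hD.map_add, mul_add]; rfl

lemma thetaOp_symm_mul (hD : IsDividedDiff D) (i : Idx n) {p : MvPolynomial (Fin n) ℤ}
    (hp : sOp i p = p) (f : MvPolynomial (Fin n) ℤ) :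
    thetaOp D i (p * f) = p * thetaOp D i f := by
  rw [thetaOp, hD.map_symm_mul i hp, mul_left_comm]; rfl

lemma thetaOp_symm (hD : IsDividedDiff D) (i : Idx n) {p : MvPolynomial (Fin n) ℤ}
    (hp : sOp i p = p) : thetaOp D i p = 0 := by
  rw [thetaOp, hD.map_symm i hp, mul_zero]

lemma piOp_eq (hD : IsDividedDiff D) (i : Idx n) (f : MvPolynomial (Fin n) ℤ) :
    piOp D i f = f + thetaOp D i f := by
  refine hD.eq_of_mul_eq ?_
  rw [mul_add, hD.thetaOp_mul, sOp_mul, sOp_X, simpleT_low]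
  ring

lemma symm_mul_X_mul_thetaOp (hD : IsDividedDiff D) (i : Idx n) {p : MvPolynomial (Fin n) ℤ}
    (hp : sOp i p = p) (f : MvPolynomial (Fin n) ℤ) :
    p * X (idxLow i) * thetaOp D i f = piOp D i (p * X (idxHigh i) * f) := by
  have hq : sOp i (p * (X (idxLow i) * X (idxHigh i))) = p * (X (idxLow i) * X (idxHigh i)) := by
    rw [sOp_mul, sOp_mul, sOp_X, sOp_X, simpleT_low, simpleT_high, hp, mul_comm (X _) (X _)]
  rw [piOp, thetaOp, show X (idxLow i) * (p * X (idxHigh i) * f) =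
    p * (X (idxLow i) * X (idxHigh i)) * f by ring, hD.map_symm_mul i hq]
  ring

lemma thetaOp_thetaOp_self (hD : IsDividedDiff D) (i : Idx n) (f : MvPolynomial (Fin n) ℤ) :
    thetaOp D i (f + thetaOp D i f) = 0 := by
  rw [← hD.piOp_eq]
  refine hD.thetaOp_symm i (mul_left_cancel₀ (X_low_sub_X_high_ne_zero i) ?_)
  have h1 := hD i (X (idxLow i) * f)
  have h2 := congrArg (sOp i) h1
  simp only [sOp_mul, sOp_sub, sOp_X, sOp_self, simpleT_low, simpleT_high] at h1 h2
  rw [piOp]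
  linear_combination -h1 - h2

lemma toFrac_rename_thetaOp (hD : IsDividedDiff D) (τ : Equiv.Perm (Fin n)) (i : Idx n)
    (f : MvPolynomial (Fin n) ℤ) :
    toFrac n (rename τ (thetaOp D i f)) =
      toFrac n (X (τ (idxHigh i))) *
        (toFrac n (rename τ f) - toFrac n (rename τ (sOp i f))) /
        (toFrac n (X (τ (idxLow i))) - toFrac n (X (τ (idxHigh i)))) := by
  have hne := toFrac_X_sub_ne_zero (τ.injective.ne (idxLow_lt_idxHigh i).ne)
  have h := congrArg (rename τ) (hD.thetaOp_mul i f)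
  simp only [map_mul, map_sub, rename_X] at h
  rw [eq_div_iff hne, ← map_sub, ← map_sub, ← map_mul, ← map_mul, mul_comm, h]

lemma toFrac_thetaOp (hD : IsDividedDiff D) (i : Idx n) (f : MvPolynomial (Fin n) ℤ) :
    toFrac n (thetaOp D i f) =
      toFrac n (X (idxHigh i)) * (toFrac n f - toFrac n (sOp i f)) /
        (toFrac n (X (idxLow i)) - toFrac n (X (idxHigh i))) := by
  simpa [rename_id_apply] using hD.toFrac_rename_thetaOp 1 i f

lemma toFrac_sOp_thetaOp (hD : IsDividedDiff D) (i j : Idx n) (f : MvPolynomial (Fin n) ℤ) :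
    toFrac n (sOp j (thetaOp D i f)) =
      toFrac n (X (simpleT j (idxHigh i))) *
        (toFrac n (sOp j f) - toFrac n (sOp j (sOp i f))) /
        (toFrac n (X (simpleT j (idxLow i))) - toFrac n (X (simpleT j (idxHigh i)))) :=
  hD.toFrac_rename_thetaOp (simpleT j) i f

lemma toFrac_sOp_sOp_thetaOp (hD : IsDividedDiff D) (i j k : Idx n)
    (f : MvPolynomial (Fin n) ℤ) :
    toFrac n (sOp k (sOp j (thetaOp D i f))) =
      toFrac n (X (simpleT k (simpleT j (idxHigh i)))) *
        (toFrac n (sOp k (sOp j f)) - toFrac n (sOp k (sOp j (sOp i f)))) /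
        (toFrac n (X (simpleT k (simpleT j (idxLow i)))) -
          toFrac n (X (simpleT k (simpleT j (idxHigh i))))) := by
  simpa only [sOp_sOp k j, Equiv.Perm.mul_apply] using hD.toFrac_rename_thetaOp (simpleT k * simpleT j) i f

lemma thetaOp_comm (hD : IsDividedDiff D) {i j : Idx n} (h : i.1 + 1 < j.1)
    (f : MvPolynomial (Fin n) ℤ) :
    thetaOp D i (thetaOp D j f) = thetaOp D j (thetaOp D i f) := by
  apply toFrac_injective n
  have h1 : simpleT i (idxLow j) = idxLow j := by
    simp only [Fin.ext_iff, simpleT_val, idxLow]; split_ifs <;> omega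
  have h2 : simpleT i (idxHigh j) = idxHigh j := by
    simp only [Fin.ext_iff, simpleT_val, idxHigh]; split_ifs <;> omega
  have h3 : simpleT j (idxLow i) = idxLow i := by
    simp only [Fin.ext_iff, simpleT_val, idxLow]; split_ifs <;> omega
  have h4 : simpleT j (idxHigh i) = idxHigh i := by
    simp only [Fin.ext_iff, simpleT_val, idxHigh]; split_ifs <;> omega
  simp only [hD.toFrac_thetaOp, hD.toFrac_sOp_thetaOp, h1, h2, h3, h4, sOp_comm h]
  have hi := toFrac_X_sub_ne_zero (idxLow_lt_idxHigh i).ne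
  have hj := toFrac_X_sub_ne_zero (idxLow_lt_idxHigh j).ne
  field_simp
  ring

lemma thetaOp_braid (hD : IsDividedDiff D) {i j : Idx n} (h : j.1 = i.1 + 1)
    (f : MvPolynomial (Fin n) ℤ) :
    thetaOp D i (thetaOp D j (thetaOp D i f)) = thetaOp D j (thetaOp D i (thetaOp D j f)) := by
  apply toFrac_injective n
  have hij : idxLow j = idxHigh i := Fin.ext h
  have hlt : idxHigh i < idxHigh j := hij ▸ idxLow_lt_idxHigh j
  have h1 : simpleT i (idxHigh j) = idxHigh j := by
    simp only [Fin.ext_iff, simpleT_val, idxHigh]; split_ifs <;> omega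
  have h2 : simpleT j (idxLow i) = idxLow i := by
    simp only [Fin.ext_iff, simpleT_val, idxLow]; split_ifs <;> omega
  have h3 : simpleT j (idxHigh i) = idxHigh j := hij ▸ simpleT_low j
  have h4 : simpleT j (idxHigh j) = idxHigh i := hij ▸ simpleT_high j
  simp only [hD.toFrac_thetaOp, hD.toFrac_sOp_thetaOp, hD.toFrac_sOp_sOp_thetaOp, hij, h1, h2,
    h3, h4, simpleT_low, simpleT_high, sOp_self, sOp_braid h]
  have ha := toFrac_X_sub_ne_zero (idxLow_lt_idxHigh i).ne
  have hb := toFrac_X_sub_ne_zero hlt.ne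
  have hc := toFrac_X_sub_ne_zero ((idxLow_lt_idxHigh i).trans hlt).ne
  have ha' := toFrac_X_sub_ne_zero (idxLow_lt_idxHigh i).ne'
  have hb' := toFrac_X_sub_ne_zero hlt.ne'
  generalize toFrac n (X (idxLow i)) = a at *
  generalize toFrac n (X (idxHigh i)) = b at *
  generalize toFrac n (X (idxHigh j)) = c at *
  rw [← neg_sub a b, ← neg_sub b c]
  field_simp
  ring

lemma thetaWord_add (hD : IsDividedDiff D) (w : List (Idx n)) (f g : MvPolynomial (Fin n) ℤ) :
    thetaWord D w (f + g) = thetaWord D w f + thetaWord D w g := by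
  induction w with
  | nil => rfl
  | cons i w ih => rw [thetaWord, ih, hD.thetaOp_add]; rfl

lemma thetaWord_zero (hD : IsDividedDiff D) (w : List (Idx n)) : thetaWord D w 0 = 0 := by
  simpa using hD.thetaWord_add w 0 0

end IsDividedDiff

lemma thetaWord_append {n : ℕ} (D : DD n) (v w : List (Idx n)) (f : MvPolynomial (Fin n) ℤ) :
    thetaWord D (v ++ w) f = thetaWord D v (thetaWord D w f) := by
  induction v with
  | nil => rfl
  | cons i v ih => rw [List.cons_append, thetaWord, ih]; rfl

lemma piWord_append {n : ℕ} (D : DD n) (v w : List (Idx n)) (f : MvPolynomial (Fin n) ℤ) :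
    piWord D (v ++ w) f = piWord D v (piWord D w f) := by
  induction v with
  | nil => rfl
  | cons i v ih => rw [List.cons_append, piWord, ih]; rfl

lemma IsTight.congr {n : ℕ} {v w : List (Idx n)} (hv : IsTight v) (h : wordProd v = wordProd w)
    (hl : v.length = w.length) : IsTight w := by
  rw [IsTight, ← hl, ← h]
  exact hv

lemma IsTight.length_eq {n : ℕ} {v w : List (Idx n)} (hv : IsTight v) (hw : IsTight w)
    (h : wordProd v = wordProd w) : v.length = w.length := by
  rw [hv, hw, h]

/-- Matsumoto's theorem for the operators `θ`: all reduced words of a permutation give the same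
operator. -/
theorem IsDividedDiff.thetaWord_eq_of_wordProd_eq {n : ℕ} {D : DD n} (hD : IsDividedDiff D)
    {v w : List (Idx n)} (hv : IsTight v) (hw : IsTight w) (h : wordProd v = wordProd w)
    (f : MvPolynomial (Fin n) ℤ) : thetaWord D v f = thetaWord D w f := by
  induction hN : v.length using Nat.strong_induction_on generalizing v w f with
  | _ N ih =>
    have aux : ∀ (i j : Idx n) (v w : List (Idx n)), i.1 < j.1 → IsTight (i :: v) →
        IsTight (j :: w) → wordProd (i :: v) = wordProd (j :: w) → v.length + 1 = N →
        thetaWord D (i :: v) f = thetaWord D (j :: w) f := by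
      intro i j v w hij hv hw h hN
      have hvt := ((isTight_cons_iff i v).1 hv).1
      have hwt := ((isTight_cons_iff j w).1 hw).1
      have hl : v.length = w.length := by simpa using hv.length_eq hw h
      have hj := hw.inv_gt
      rw [← h] at hj
      have hi := hv.inv_gt
      have hjv : (wordProd v)⁻¹ (simpleT i (idxHigh j)) <
          (wordProd v)⁻¹ (simpleT i (idxLow j)) := by
        rwa [wordProd_cons, simpleT_mul_inv] at hj
      rcases Nat.lt_or_ge (i.1 + 1) j.1 with hfar | hnear
      · have h1 : simpleT i (idxLow j) = idxLow j := by
          simp only [Fin.ext_iff, simpleT_val, idxLow]; split_ifs <;> omega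
        have h2 : simpleT i (idxHigh j) = idxHigh j := by
          simp only [Fin.ext_iff, simpleT_val, idxHigh]; split_ifs <;> omega
        rw [h1, h2] at hjv
        obtain ⟨c, hc, hct⟩ := exists_isTight_cons (wordProd v) j hjv
        have hlc : v.length = (j :: c).length := hvt.length_eq hct hc.symm
        have hp : wordProd (j :: i :: c) = wordProd (j :: w) := by
          rw [← h, wordProd_cons i v, ← hc]
          simp only [wordProd_cons, ← mul_assoc, simpleT_comm hfar]
        have hct' : IsTight (i :: c) :=
          ((isTight_cons_iff j _).1 (hw.congr hp.symm (by simp at hlc ⊢; omega))).1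
        have hp' : wordProd w = wordProd (i :: c) := by
          rw [wordProd_cons j, wordProd_cons j] at hp
          exact (mul_left_cancel hp).symm
        simp only [thetaWord]
        rw [ih _ (by omega) hvt hct hc.symm f rfl, ih _ (by omega) hwt hct' hp' f rfl]
        exact hD.thetaOp_comm hfar _
      · have hji : j.1 = i.1 + 1 := by omega
        have hlow : idxLow j = idxHigh i := Fin.ext hji
        have h1 : simpleT i (idxHigh j) = idxHigh j := by
          simp only [Fin.ext_iff, simpleT_val, idxHigh]; split_ifs <;> omega
        have h2 : simpleT j (idxLow i) = idxLow i := by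
          simp only [Fin.ext_iff, simpleT_val, idxLow]; split_ifs <;> omega
        have h3 : simpleT j (idxHigh i) = idxHigh j := hlow ▸ simpleT_low j
        rw [h1, hlow, simpleT_high] at hjv
        obtain ⟨b, hb, hbt⟩ := exists_isTight_cons (wordProd v) j (by
          rw [hlow]
          refine hjv.trans ?_
          rw [wordProd_cons, simpleT_mul_inv] at hi
          simpa using hi)
        have hbi : (wordProd b)⁻¹ (idxHigh i) < (wordProd b)⁻¹ (idxLow i) := by
          rw [← hb, wordProd_cons, simpleT_mul_inv] at hjv
          simpa [h2, hlow ▸ simpleT_high j] using hjv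
        obtain ⟨c, hc, hct⟩ := exists_isTight_cons (wordProd b) i hbi
        have hlb : v.length = (j :: b).length := hvt.length_eq hbt hb.symm
        have hlc : b.length = (i :: c).length :=
          ((isTight_cons_iff j b).1 hbt).1.length_eq hct hc.symm
        rw [List.length_cons] at hlb hlc
        have hpv : wordProd (j :: i :: c) = wordProd v := by
          rw [wordProd_cons, hc, ← hb, wordProd_cons]
        have hctv : IsTight (j :: i :: c) := hvt.congr hpv.symm (by simp; omega)
        have hp : wordProd (j :: i :: j :: c) = wordProd (j :: w) := by
          rw [← h, wordProd_cons i v, ← hpv]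
          simp only [wordProd_cons, ← mul_assoc, simpleT_braid hji]
        have hctw : IsTight (i :: j :: c) :=
          ((isTight_cons_iff j _).1 (hw.congr hp.symm (by simp; omega))).1
        have hpw : wordProd w = wordProd (i :: j :: c) := by
          rw [wordProd_cons j, wordProd_cons j] at hp
          exact (mul_left_cancel hp).symm
        simp only [thetaWord]
        rw [ih _ (by omega) hvt hctv hpv.symm f rfl, ih _ (by omega) hwt hctw hpw f rfl]
        exact hD.thetaOp_braid hji _
    match v, w with
    | [], [] => rfl
    | [], _ :: _ => simpa using hv.length_eq hw h
    | _ :: _, [] => simpa using hv.length_eq hw h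
    | i :: v, j :: w =>
      rw [List.length_cons] at hN
      have hl : v.length = w.length := by simpa using hv.length_eq hw h
      rcases lt_trichotomy i.1 j.1 with hij | hij | hij
      · exact aux i j v w hij hv hw h hN
      · obtain rfl := Subtype.ext hij
        rw [wordProd_cons, wordProd_cons] at h
        rw [thetaWord, thetaWord, ih _ (by omega) ((isTight_cons_iff i v).1 hv).1
          ((isTight_cons_iff i w).1 hw).1 (mul_left_cancel h) f rfl]
      · exact (aux j i w v hij hw hv h.symm (by omega)).symm

namespace AtomPos

variable {n : ℕ} {D : DD n}

lemma add {f g : MvPolynomial (Fin n) ℤ} (hf : AtomPos D f) (hg : AtomPos D g) :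
    AtomPos D (f + g) := add_mem hf hg

lemma zero : AtomPos D 0 := zero_mem _

lemma of_isTight {w : List (Idx n)} (hw : IsTight w) {lam : Fin n → ℕ} (hlam : Antitone lam) :
    AtomPos D (thetaWord D w (xpow lam)) :=
  AddSubmonoid.subset_closure ⟨w, _, lam, (isReducedWord_iff w _).2 ⟨rfl, hw⟩, hlam, rfl⟩

/-- `θ_u π_v` is a sum of operators `θ_x`, because `θ_u π_i` is either `0` or
`θ_u + θ_{u s_i}`. -/
lemma thetaWord_piWord (hD : IsDividedDiff D) {u : List (Idx n)} (hu : IsTight u)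
    (v : List (Idx n)) {lam : Fin n → ℕ} (hlam : Antitone lam) :
    AtomPos D (thetaWord D u (piWord D v (xpow lam))) := by
  induction v generalizing u with
  | nil => exact of_isTight hu hlam
  | cons i v ih =>
    rw [piWord, hD.piOp_eq]
    rcases perm_low_lt_or_gt (wordProd u) i with h | h
    · rw [hD.thetaWord_add]
      refine (ih hu).add ?_
      simpa only [thetaWord_append, thetaWord] using ih ((isTight_concat_iff u i).2 ⟨hu, h⟩)
    · obtain ⟨u', hp, ht⟩ := exists_isTight_concat (wordProd u) i h
      rw [hD.thetaWord_eq_of_wordProd_eq hu ht hp.symm, thetaWord_append]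
      simp only [thetaWord]
      rw [hD.thetaOp_thetaOp_self, hD.thetaWord_zero]
      exact zero

end AtomPos

/-- The indicator function of the positions at which `σ` takes a value below `k`. -/
def belowInd {n : ℕ} (k : ℕ) (σ : Equiv.Perm (Fin n)) (j : Fin n) : ℕ :=
  if (σ j : ℕ) < k then 1 else 0

lemma sOp_xpow_belowInd_one {n : ℕ} {k : ℕ} {i : Idx n} (hi : i.1 + 1 ≠ k) :
    sOp i (xpow (belowInd k 1)) = xpow (belowInd k 1) := by
  rw [sOp_xpow]
  congr 1
  funext j
  simp only [belowInd, Function.comp_apply, Equiv.Perm.one_apply, simpleT_val]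
  grind

lemma xpow_single {n : ℕ} (j : Fin n) : xpow (Pi.single j 1) = X j := by
  rw [xpow, Finset.prod_eq_single j]
  · simp
  · intro b _ hb
    simp [hb]
  · simp

lemma IsDividedDiff.xpow_belowInd_mul_thetaOp {n : ℕ} {D : DD n} (hD : IsDividedDiff D) {k : ℕ}
    {σ : Equiv.Perm (Fin n)} {i : Idx n} (hlow : (σ (idxLow i) : ℕ) < k)
    (hhigh : k ≤ (σ (idxHigh i) : ℕ)) (f : MvPolynomial (Fin n) ℤ) :
    xpow (belowInd k σ) * thetaOp D i f =
      piOp D i (xpow (belowInd k (σ * simpleT i)) * f) := by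
  have hne := (idxLow_lt_idxHigh i).ne
  let q : Fin n → ℕ := fun j => if j = idxLow i ∨ j = idxHigh i then 0 else belowInd k σ j
  have hq : sOp i (xpow q) = xpow q := by
    rw [sOp_xpow]
    congr 1
    funext j
    simp only [q, Function.comp_apply, simpleT_apply]
    grind
  have h1 : belowInd k σ = q + Pi.single (idxLow i) 1 := by
    funext j
    simp only [q, belowInd, Pi.add_apply, Pi.single_apply]
    grind
  have h2 : belowInd k (σ * simpleT i) = q + Pi.single (idxHigh i) 1 := by
    funext j
    simp only [q, belowInd, Pi.add_apply, Pi.single_apply, Equiv.Perm.mul_apply, simpleT_apply]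
    grind
  rw [h1, h2, xpow_add, xpow_add, xpow_single, xpow_single, hD.symm_mul_X_mul_thetaOp i hq]

/-- All inversions of `σ` are between values below `k` and values at least `k`, that is, `σ⁻¹` is
increasing on both sides of `k`. -/
def IsGrassmannian {n : ℕ} (k : ℕ) (σ : Equiv.Perm (Fin n)) : Prop :=
  ∀ x y, x < y → σ y < σ x → (σ y : ℕ) < k ∧ k ≤ (σ x : ℕ)

lemma IsGrassmannian.of_mul_simpleT {n : ℕ} {k : ℕ} {σ : Equiv.Perm (Fin n)} {i : Idx n}
    (h : IsGrassmannian k (σ * simpleT i)) (hi : σ (idxLow i) < σ (idxHigh i)) :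
    IsGrassmannian k σ := by
  intro x y hxy hσ
  simpa using h _ _ (simpleT_lt i hxy (by rintro ⟨rfl, rfl⟩; exact hσ.asymm hi)) (by simpa)

lemma IsDividedDiff.xpow_belowInd_mul_thetaWord {n : ℕ} {D : DD n} (hD : IsDividedDiff D)
    {k : ℕ} {v : List (Idx n)} (hv : IsTight v) (hk : IsGrassmannian k (wordProd v))
    (f : MvPolynomial (Fin n) ℤ) :
    xpow (belowInd k 1) * thetaWord D v f =
      piWord D v (xpow (belowInd k (wordProd v)) * f) := by
  induction v using List.reverseRecOn generalizing f with
  | nil => rfl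
  | append_singleton v i ih =>
    obtain ⟨hv', hi⟩ := (isTight_concat_iff v i).1 hv
    rw [wordProd_concat] at hk
    have hki := hk _ _ (idxLow_lt_idxHigh i) (by simpa using hi)
    simp only [Equiv.Perm.mul_apply, simpleT_low, simpleT_high] at hki
    rw [thetaWord_append, ih hv' (hk.of_mul_simpleT hi), piWord_append, wordProd_concat]
    simp only [thetaWord, piWord]
    rw [hD.xpow_belowInd_mul_thetaOp hki.1 hki.2]

lemma IsDividedDiff.xpow_belowInd_one_mul_thetaWord {n : ℕ} {D : DD n} (hD : IsDividedDiff D)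
    {k : ℕ} {u : List (Idx n)} (hu : ∀ i ∈ u, i.1 + 1 ≠ k) (f : MvPolynomial (Fin n) ℤ) :
    xpow (belowInd k 1) * thetaWord D u f = thetaWord D u (xpow (belowInd k 1) * f) := by
  induction u with
  | nil => rfl
  | cons i u ih =>
    rw [List.forall_mem_cons] at hu
    rw [thetaWord, thetaWord, ← ih hu.2, hD.thetaOp_symm_mul i (sOp_xpow_belowInd_one hu.1)]

lemma wordProd_apply_lt_iff {n : ℕ} {k : ℕ} {u : List (Idx n)} (hu : ∀ i ∈ u, i.1 + 1 ≠ k)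
    (x : Fin n) : (wordProd u x : ℕ) < k ↔ (x : ℕ) < k := by
  induction u with
  | nil => rfl
  | cons i u ih =>
    rw [List.forall_mem_cons] at hu
    rw [← ih hu.2, wordProd_cons, Equiv.Perm.mul_apply, simpleT_val]
    grind

/-- Parabolic factorization of a permutation with respect to the stabilizer of `{0, …, k - 1}`. -/
lemma exists_isTight_append_isGrassmannian {n : ℕ} (k : ℕ) (σ : Equiv.Perm (Fin n)) :
    ∃ u v : List (Idx n), wordProd (u ++ v) = σ ∧ IsTight (u ++ v) ∧ (∀ i ∈ u, i.1 + 1 ≠ k) ∧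
      IsGrassmannian k (wordProd v) := by
  induction hN : invNum σ using Nat.strong_induction_on generalizing σ with
  | _ N ih =>
    by_cases h : ∀ i : Idx n, i.1 + 1 ≠ k → σ⁻¹ (idxLow i) < σ⁻¹ (idxHigh i)
    · obtain ⟨v, rfl, hv⟩ := exists_isTight σ
      refine ⟨[], v, rfl, hv, by simp, fun x y hxy hσ => ?_⟩
      by_contra hcon
      have := le_of_forall_idx_le ⇑(wordProd v)⁻¹ hσ.le fun i h1 h2 => (h i fun hi => ?_).le
      · simp only [Equiv.symm_apply_apply, Equiv.Perm.inv_def] at this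
        exact this.not_gt hxy
      · simp only [Fin.le_def, idxLow, idxHigh] at h1 h2
        omega
    · push Not at h
      obtain ⟨i, hik, hi⟩ := h
      have hi' := (perm_low_lt_or_gt σ⁻¹ i).resolve_left hi.not_gt
      have hlen := invNum_simpleT_mul_of_gt σ i hi'
      obtain ⟨u, v, hp, ht, hu, hv⟩ := ih _ (by omega) (simpleT i * σ) rfl
      refine ⟨i :: u, v, ?_, ?_, List.forall_mem_cons.2 ⟨hik, hu⟩, hv⟩
      · rw [List.cons_append, wordProd_cons, hp, ← mul_assoc, simpleT_mul_self, one_mul]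
      · rw [List.cons_append, isTight_cons_iff, hp, simpleT_mul_inv]
        exact ⟨ht, by simpa using hi'⟩

/-- A word that is not of minimal length in its coset of the stabilizer of `λ` kills `x^λ`. -/
lemma IsDividedDiff.thetaWord_xpow_eq_zero {n : ℕ} {D : DD n} (hD : IsDividedDiff D)
    {w : List (Idx n)} (hw : IsTight w) {lam : Fin n → ℕ} {i : Idx n}
    (hlam : lam (idxLow i) = lam (idxHigh i))
    (hi : wordProd w (idxHigh i) < wordProd w (idxLow i)) : thetaWord D w (xpow lam) = 0 := by
  obtain ⟨v, hp, ht⟩ := exists_isTight_concat (wordProd w) i hi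
  rw [hD.thetaWord_eq_of_wordProd_eq hw ht hp.symm, thetaWord_append]
  simp only [thetaWord]
  rw [hD.thetaOp_symm, hD.thetaWord_zero]
  rw [sOp_xpow]
  congr 1
  funext j
  simp only [Function.comp_apply, simpleT_apply]
  grind

namespace AtomPos

variable {n : ℕ} {D : DD n}

lemma xpow_belowInd_mul_thetaWord (hD : IsDividedDiff D) (k : ℕ) {w : List (Idx n)}
    (hw : IsTight w) {lam : Fin n → ℕ} (hlam : Antitone lam) :
    AtomPos D (xpow (belowInd k 1) * thetaWord D w (xpow lam)) := by
  by_cases h : ∃ i : Idx n, lam (idxLow i) = lam (idxHigh i) ∧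
      wordProd w (idxHigh i) < wordProd w (idxLow i)
  · obtain ⟨i, hi, hi'⟩ := h
    rw [hD.thetaWord_xpow_eq_zero hw hi hi', mul_zero]
    exact zero
  · push Not at h
    obtain ⟨u, v, hp, ht, hu, hv⟩ := exists_isTight_append_isGrassmannian k (wordProd w)
    rw [hD.thetaWord_eq_of_wordProd_eq hw ht hp.symm, thetaWord_append,
      hD.xpow_belowInd_one_mul_thetaWord hu,
      hD.xpow_belowInd_mul_thetaWord ht.of_append_right hv, ← xpow_add]
    refine thetaWord_piWord hD ht.of_append_left v (antitone_of_forall_idx_le _ fun i => ?_)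
    have hw' : belowInd k (wordProd v) = belowInd k (wordProd w) := by
      funext j
      simp only [belowInd, ← hp, wordProd_append, Equiv.Perm.mul_apply, wordProd_apply_lt_iff hu]
    rw [hw']
    have hle := hlam (idxLow_lt_idxHigh i).le
    have hi := h i
    simp only [Pi.add_apply, belowInd, Fin.le_def] at *
    split_ifs <;> omega

lemma xpow_belowInd_mul (hD : IsDividedDiff D) (k : ℕ) {f : MvPolynomial (Fin n) ℤ}
    (hf : AtomPos D f) : AtomPos D (xpow (belowInd k 1) * f) := by
  induction hf using AddSubmonoid.closure_induction with
  | mem f hf =>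
    obtain ⟨w, σ, lam, hw, hlam, rfl⟩ := hf
    exact xpow_belowInd_mul_thetaWord hD k ((isReducedWord_iff w σ).1 hw).2 hlam
  | zero => rw [mul_zero]; exact zero
  | add f g _ _ hf hg => rw [mul_add]; exact hf.add hg

/-- Atom-positivity is preserved by multiplication by dominant monomials. -/
theorem xpow_mul (hD : IsDividedDiff D) {mu : Fin n → ℕ} (hmu : Antitone mu)
    {f : MvPolynomial (Fin n) ℤ} (hf : AtomPos D f) : AtomPos D (xpow mu * f) := by
  induction hN : ∑ j, mu j using Nat.strong_induction_on generalizing mu with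
  | _ N ih =>
    by_cases h0 : ∀ j, mu j = 0
    · have : xpow mu = 1 := by simp [xpow, h0]
      rwa [this, one_mul]
    · have hex : ∃ k, ∀ j : Fin n, 0 < mu j → (j : ℕ) < k := ⟨n, fun j _ => j.2⟩
      have hk : ∀ j : Fin n, 0 < mu j ↔ (j : ℕ) < Nat.find hex := by
        refine fun j => ⟨Nat.find_spec hex j, fun hj => ?_⟩
        by_contra hmj
        refine Nat.find_min hex hj fun l hl => ?_
        by_contra hjl
        have : mu l ≤ mu j := hmu (not_lt.1 hjl)
        omega
      have hsplit : mu = belowInd (Nat.find hex) 1 + fun j => mu j - 1 := by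
        funext j
        have hj := hk j
        rw [Pi.add_apply, belowInd, Equiv.Perm.one_apply]
        split_ifs with h <;> rw [← hj] at h <;> omega
      rw [hsplit, xpow_add, mul_assoc]
      refine xpow_belowInd_mul hD _ (ih _ ?_ (fun _ _ hab => Nat.sub_le_sub_right (hmu hab) 1) rfl)
      push Not at h0
      obtain ⟨j, hj⟩ := h0
      rw [← hN]
      exact Finset.sum_lt_sum (fun _ _ => Nat.sub_le _ _) ⟨j, Finset.mem_univ j, by omega⟩

end AtomPos

/-- the product of a dominating monomial and a Demazure atom is
atom-positive. -/
theorem stmt16 (n : ℕ) (D : DD n) (hD : IsDividedDiff D)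
    (mu : Fin n → ℕ) (hmu : Antitone mu) (alpha : Fin n → ℕ)
    (u : Equiv.Perm (Fin n)) (hu : Antitone (alpha ∘ ⇑u))
    (humin : ∀ v : Equiv.Perm (Fin n), Antitone (alpha ∘ ⇑v) → len u ≤ len v)
    (w : List (Idx n)) (hw : IsReducedWord w u⁻¹) :
    AtomPos D (xpow mu * thetaWord D w (xpow (alpha ∘ ⇑u))) := by
  exact AtomPos.xpow_mul hD hmu (AtomPos.of_isTight ((isReducedWord_iff w _).1 hw).2 hu)
end

section
/- Let λ : Fin n → ℕ and ν : Fin n → ℕ be partitions and let w be any finite word of indices. Then the product x^λ * π_w(x^ν) (the product of the Demazure atom A_λ = x^λ, a dominating monomial, with a key polynomial) is key-positive. -/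
open MvPolynomial

namespace KeyProduct

variable {n : ℕ}

lemma idxLow_ne_idxHigh (i : Idx n) : idxLow i ≠ idxHigh i := by
  simp [idxLow, idxHigh, Fin.ext_iff]

@[simp] lemma simpleT_low (i : Idx n) : simpleT i (idxLow i) = idxHigh i :=
  Equiv.swap_apply_left _ _

@[simp] lemma simpleT_high (i : Idx n) : simpleT i (idxHigh i) = idxLow i :=
  Equiv.swap_apply_right _ _

lemma simpleT_of_ne (i : Idx n) {k : Fin n} (h₁ : k ≠ idxLow i) (h₂ : k ≠ idxHigh i) :
    simpleT i k = k :=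
  Equiv.swap_apply_of_ne_of_ne h₁ h₂

@[simp] lemma simpleT_simpleT (i : Idx n) (k : Fin n) : simpleT i (simpleT i k) = k :=
  Equiv.swap_apply_self _ _ _

@[simp] lemma comp_simpleT_comp_simpleT (i : Idx n) (mu : Fin n → ℕ) :
    (mu ∘ simpleT i) ∘ simpleT i = mu := by
  funext k; simp

lemma sOp_add (i : Idx n) (f g : MvPolynomial (Fin n) ℤ) :
    sOp i (f + g) = sOp i f + sOp i g := map_add _ _ _

lemma sOp_sub (i : Idx n) (f g : MvPolynomial (Fin n) ℤ) :
    sOp i (f - g) = sOp i f - sOp i g := map_sub _ _ _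

lemma sOp_mul (i : Idx n) (f g : MvPolynomial (Fin n) ℤ) :
    sOp i (f * g) = sOp i f * sOp i g := map_mul _ _ _

lemma sOp_X (i : Idx n) (k : Fin n) : sOp i (X k) = X (simpleT i k) := rename_X _ _

lemma sOp_sOp_comp (i j : Idx n) (f : MvPolynomial (Fin n) ℤ) :
    sOp i (sOp j f) = rename (simpleT i ∘ simpleT j) f := rename_rename _ _ _

lemma sOp_sOp (i : Idx n) (f : MvPolynomial (Fin n) ℤ) : sOp i (sOp i f) = f := by
  have : simpleT i ∘ simpleT i = id := by funext k; simp
  rw [sOp_sOp_comp, this, rename_id_apply]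

lemma X_sub_X_ne_zero {a b : Fin n} (h : a ≠ b) :
    (X a - X b : MvPolynomial (Fin n) ℤ) ≠ 0 :=
  sub_ne_zero.mpr fun h' => h (X_injective h')

lemma low_sub_high_ne_zero (i : Idx n) :
    (X (idxLow i) - X (idxHigh i) : MvPolynomial (Fin n) ℤ) ≠ 0 :=
  X_sub_X_ne_zero (idxLow_ne_idxHigh i)

section Operators

variable {D : DD n}

lemma sub_mul_piOp (hD : IsDividedDiff D) (i : Idx n) (f : MvPolynomial (Fin n) ℤ) :
    (X (idxLow i) - X (idxHigh i)) * piOp D i f =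
      X (idxLow i) * f - X (idxHigh i) * sOp i f := by
  rw [piOp, hD, sOp_mul, sOp_X, simpleT_low]

lemma piOp_add (hD : IsDividedDiff D) (i : Idx n) (f g : MvPolynomial (Fin n) ℤ) :
    piOp D i (f + g) = piOp D i f + piOp D i g := by
  apply mul_left_cancel₀ (low_sub_high_ne_zero i)
  rw [mul_add]
  simp only [sub_mul_piOp hD, sOp_add]
  ring

lemma sOp_piOp (hD : IsDividedDiff D) (i : Idx n) (f : MvPolynomial (Fin n) ℤ) :
    sOp i (piOp D i f) = piOp D i f := by
  apply mul_left_cancel₀ (low_sub_high_ne_zero i)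
  have h := congrArg (sOp i) (sub_mul_piOp hD i f)
  simp only [sOp_mul, sOp_sub, sOp_X, simpleT_low, simpleT_high, sOp_sOp] at h
  linear_combination -h - sub_mul_piOp hD i f

lemma piOp_of_sOp_eq (hD : IsDividedDiff D) (i : Idx n) {f : MvPolynomial (Fin n) ℤ}
    (h : sOp i f = f) : piOp D i f = f := by
  apply mul_left_cancel₀ (low_sub_high_ne_zero i)
  rw [sub_mul_piOp hD, h]
  ring

lemma piOp_piOp (hD : IsDividedDiff D) (i : Idx n) (f : MvPolynomial (Fin n) ℤ) :
    piOp D i (piOp D i f) = piOp D i f :=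
  piOp_of_sOp_eq hD i (sOp_piOp hD i f)

/-- The indices `i`, `j` are at distance at least two. -/
def Far (i j : Idx n) : Prop := i.1 + 1 < j.1 ∨ j.1 + 1 < i.1

lemma Far.low_ne_low {i j : Idx n} (h : Far i j) : idxLow i ≠ idxLow j := by
  simp only [Far] at h; simp only [idxLow, ne_eq, Fin.mk.injEq]; omega

lemma Far.low_ne_high {i j : Idx n} (h : Far i j) : idxLow i ≠ idxHigh j := by
  simp only [Far] at h; simp only [idxLow, idxHigh, ne_eq, Fin.mk.injEq]; omega

lemma Far.high_ne_low {i j : Idx n} (h : Far i j) : idxHigh i ≠ idxLow j := by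
  simp only [Far] at h; simp only [idxLow, idxHigh, ne_eq, Fin.mk.injEq]; omega

lemma Far.high_ne_high {i j : Idx n} (h : Far i j) : idxHigh i ≠ idxHigh j := by
  simp only [Far] at h; simp only [idxHigh, ne_eq, Fin.mk.injEq]; omega

lemma Far.symm {i j : Idx n} (h : Far i j) : Far j i := Or.symm h

lemma Far.simpleT_low {i j : Idx n} (h : Far i j) : simpleT i (idxLow j) = idxLow j :=
  simpleT_of_ne _ h.low_ne_low.symm h.high_ne_low.symm

lemma Far.simpleT_high {i j : Idx n} (h : Far i j) : simpleT i (idxHigh j) = idxHigh j :=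
  simpleT_of_ne _ h.low_ne_high.symm h.high_ne_high.symm

lemma Far.simpleT_comm {i j : Idx n} (h : Far i j) :
    simpleT i ∘ simpleT j = simpleT j ∘ simpleT i := by
  funext k
  simp only [Function.comp_apply]
  by_cases h₁ : k = idxLow i
  · subst h₁; simp [h.symm.simpleT_low, h.symm.simpleT_high]
  by_cases h₂ : k = idxHigh i
  · subst h₂; simp [h.symm.simpleT_low, h.symm.simpleT_high]
  by_cases h₃ : k = idxLow j
  · subst h₃; simp [h.simpleT_low, h.simpleT_high]
  by_cases h₄ : k = idxHigh j
  · subst h₄; simp [h.simpleT_low, h.simpleT_high]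
  simp [simpleT_of_ne, h₁, h₂, h₃, h₄]

lemma piOp_comm (hD : IsDividedDiff D) {i j : Idx n} (h : Far i j)
    (f : MvPolynomial (Fin n) ℤ) : piOp D i (piOp D j f) = piOp D j (piOp D i f) := by
  apply mul_left_cancel₀ (mul_ne_zero (low_sub_high_ne_zero i) (low_sub_high_ne_zero j))
  have hij := congrArg (sOp i) (sub_mul_piOp hD j f)
  have hji := congrArg (sOp j) (sub_mul_piOp hD i f)
  simp only [sOp_mul, sOp_sub, sOp_X, h.simpleT_low, h.simpleT_high, h.symm.simpleT_low,
    h.symm.simpleT_high] at hij hji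
  have hs : sOp i (sOp j f) = sOp j (sOp i f) := by
    rw [sOp_sOp_comp, sOp_sOp_comp, h.simpleT_comm]
  rw [hs] at hij
  linear_combination (X (idxLow j) - X (idxHigh j)) * sub_mul_piOp hD i (piOp D j f)
    - (X (idxLow i) - X (idxHigh i)) * sub_mul_piOp hD j (piOp D i f)
    + X (idxLow i) * sub_mul_piOp hD j f - X (idxHigh i) * hij
    - X (idxLow j) * sub_mul_piOp hD i f + X (idxHigh j) * hji

lemma piOp_braid (hD : IsDividedDiff D) {i j : Idx n} (h : i.1 + 1 = j.1)
    (f : MvPolynomial (Fin n) ℤ) :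
    piOp D i (piOp D j (piOp D i f)) = piOp D j (piOp D i (piOp D j f)) := by
  have hb : idxLow j = idxHigh i := by simp [idxLow, idxHigh, h]
  have hac : idxLow i ≠ idxHigh j := by
    simp only [idxLow, idxHigh, ne_eq, Fin.mk.injEq]; omega
  have hic : simpleT i (idxHigh j) = idxHigh j :=
    simpleT_of_ne _ hac.symm (hb ▸ (idxLow_ne_idxHigh j).symm)
  have hja : simpleT j (idxLow i) = idxLow i :=
    simpleT_of_ne _ (hb ▸ idxLow_ne_idxHigh i) hac
  have hjb : simpleT j (idxHigh i) = idxHigh j := by rw [← hb, simpleT_low]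
  have hjc : simpleT j (idxHigh j) = idxHigh i := by rw [← hb, simpleT_high]
  have hs : sOp i (sOp j (sOp i f)) = sOp j (sOp i (sOp j f)) := by
    simp only [sOp, rename_rename]
    congr 2
    funext k
    simp only [Function.comp_apply]
    by_cases h₁ : k = idxLow i
    · subst h₁; simp [hic, hja, hjb]
    by_cases h₂ : k = idxHigh i
    · subst h₂; simp [hic, hja, hjb, hb]
    by_cases h₃ : k = idxHigh j
    · subst h₃; simp [hic, hja, hjc]
    have h₄ : k ≠ idxLow j := hb ▸ h₂
    simp [simpleT_of_ne, h₁, h₂, h₃, h₄]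
  apply mul_left_cancel₀ (mul_ne_zero (mul_ne_zero (low_sub_high_ne_zero i)
    (low_sub_high_ne_zero j)) (X_sub_X_ne_zero hac))
  -- expand both triple products over the symmetric group on three letters
  have hj := fun g => sub_mul_piOp hD j g
  have hi := fun g => sub_mul_piOp hD i g
  rw [hb] at hj ⊢
  have a₁ := hi f
  have a₂ := congrArg (sOp j) a₁
  have a₃ := congrArg (sOp i) a₂
  have a₄ := hj (piOp D i f)
  have a₅ := congrArg (sOp i) a₄
  have b₁ := hj f
  have b₂ := congrArg (sOp i) b₁
  have b₃ := congrArg (sOp j) b₂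
  have b₄ := hi (piOp D j f)
  have b₅ := congrArg (sOp j) b₄
  have a₆ := hi (piOp D j (piOp D i f))
  have b₆ := hj (piOp D i (piOp D j f))
  simp only [sOp_mul, sOp_sub, sOp_X, simpleT_low, simpleT_high, hic, hja, hjb, hjc,
    sOp_piOp hD, hs] at a₁ a₂ a₃ a₄ a₅ a₆ b₁ b₂ b₃ b₄ b₅ b₆
  generalize (X (idxLow i) : MvPolynomial (Fin n) ℤ) = a at *
  generalize (X (idxHigh i) : MvPolynomial (Fin n) ℤ) = b at *
  generalize (X (idxHigh j) : MvPolynomial (Fin n) ℤ) = c at *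
  linear_combination (b - c) * (a - c) * a₆ + (a - c) * a * a₄ - (b - c) * b * a₅
    + a * b * a₁ - a * c * a₂ + b * c * a₃
    - (a - b) * (a - c) * b₆ - (a - c) * b * b₄ + (a - b) * c * b₅
    - a ^ 2 * b₁ + b ^ 2 * b₂ - c ^ 2 * b₃

end Operators

lemma xpow_add (mu nu : Fin n → ℕ) : xpow (mu + nu) = xpow mu * xpow nu := by
  simp [xpow, pow_add, Finset.prod_mul_distrib]

lemma sOp_xpow (i : Idx n) (mu : Fin n → ℕ) : sOp i (xpow mu) = xpow (mu ∘ simpleT i) := by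
  simp only [sOp, xpow, map_prod, map_pow, rename_X, Function.comp_apply]
  exact Fintype.prod_equiv (simpleT i) _ _ fun k => by simp

lemma xpow_single (k : Fin n) : xpow (Pi.single k 1) = X k := by
  rw [xpow, Finset.prod_eq_single k] <;> simp +contextual

lemma low_mul_xpow (i : Idx n) {mu : Fin n → ℕ} (h : mu (idxHigh i) = mu (idxLow i) + 1) :
    X (idxLow i) * xpow mu = X (idxHigh i) * xpow (mu ∘ simpleT i) := by
  rw [← xpow_single, ← xpow_single, ← xpow_add, ← xpow_add]
  congr 1
  funext k
  have hne := idxLow_ne_idxHigh i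
  by_cases h₁ : k = idxLow i
  · subst h₁; simp [hne, h, add_comm]
  by_cases h₂ : k = idxHigh i
  · subst h₂; simp [hne.symm, h, add_comm]
  simp [h₁, h₂, simpleT_of_ne]

section Expansion

variable {D : DD n}

/-- The operator `π_i` as an additive endomorphism. -/
noncomputable def piEnd (hD : IsDividedDiff D) (i : Idx n) : AddMonoid.End (MvPolynomial (Fin n) ℤ) :=
  AddMonoidHom.mk' (piOp D i) (piOp_add hD i)

/-- Multiplication by the monomial `x^mu`. -/
noncomputable def mulEnd (mu : Fin n → ℕ) : AddMonoid.End (MvPolynomial (Fin n) ℤ) :=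
  AddMonoidHom.mulLeft (xpow mu)

@[simp] lemma piEnd_apply (hD : IsDividedDiff D) (i : Idx n) (f : MvPolynomial (Fin n) ℤ) :
    piEnd hD i f = piOp D i f := rfl

@[simp] lemma mulEnd_apply (mu : Fin n → ℕ) (f : MvPolynomial (Fin n) ℤ) :
    mulEnd mu f = xpow mu * f := rfl

lemma piEnd_mul_self (hD : IsDividedDiff D) (i : Idx n) :
    piEnd hD i * piEnd hD i = piEnd hD i :=
  AddMonoidHom.ext (piOp_piOp hD i)

lemma piEnd_comm (hD : IsDividedDiff D) {i j : Idx n} (h : Far i j) :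
    piEnd hD i * piEnd hD j = piEnd hD j * piEnd hD i :=
  AddMonoidHom.ext (piOp_comm hD h)

lemma piEnd_braid (hD : IsDividedDiff D) {i j : Idx n} (h : i.1 + 1 = j.1 ∨ j.1 + 1 = i.1) :
    piEnd hD i * piEnd hD j * piEnd hD i = piEnd hD j * piEnd hD i * piEnd hD j := by
  rcases h with h | h
  · exact AddMonoidHom.ext (piOp_braid hD h)
  · exact AddMonoidHom.ext fun f => (piOp_braid hD h f).symm

lemma mulEnd_mul_piEnd_of_eq (hD : IsDividedDiff D) (i : Idx n) {mu : Fin n → ℕ}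
    (h : mu ∘ simpleT i = mu) : mulEnd mu * piEnd hD i = piEnd hD i * mulEnd mu := by
  refine AddMonoidHom.ext fun f => ?_
  apply mul_left_cancel₀ (low_sub_high_ne_zero i)
  change _ * (xpow mu * piOp D i f) = _ * piOp D i (xpow mu * f)
  rw [sub_mul_piOp hD, sOp_mul, sOp_xpow, h]
  linear_combination xpow mu * sub_mul_piOp hD i f

lemma mulEnd_mul_piEnd_of_pos (hD : IsDividedDiff D) (i : Idx n) {mu : Fin n → ℕ}
    (h : mu (idxLow i) = mu (idxHigh i) + 1) :
    mulEnd mu * piEnd hD i = piEnd hD i * mulEnd (mu ∘ simpleT i) + mulEnd mu := by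
  refine AddMonoidHom.ext fun f => ?_
  apply mul_left_cancel₀ (low_sub_high_ne_zero i)
  change _ * (xpow mu * piOp D i f) = _ * (piOp D i (xpow (mu ∘ simpleT i) * f) + xpow mu * f)
  have hx := low_mul_xpow i (mu := mu ∘ simpleT i) (by simpa using h)
  rw [comp_simpleT_comp_simpleT] at hx
  rw [mul_add, sub_mul_piOp hD, sOp_mul, sOp_xpow, comp_simpleT_comp_simpleT]
  linear_combination xpow mu * sub_mul_piOp hD i f - f * hx

lemma piEnd_mul_mulEnd_mul_piEnd_of_neg (hD : IsDividedDiff D) (i : Idx n) {mu : Fin n → ℕ}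
    (h : mu (idxHigh i) = mu (idxLow i) + 1) :
    piEnd hD i * mulEnd mu * piEnd hD i = 0 := by
  have key : mulEnd mu * piEnd hD i =
      piEnd hD i * mulEnd (mu ∘ simpleT i) - mulEnd (mu ∘ simpleT i) := by
    refine AddMonoidHom.ext fun f => ?_
    apply mul_left_cancel₀ (low_sub_high_ne_zero i)
    change _ * (xpow mu * piOp D i f) =
      _ * (piOp D i (xpow (mu ∘ simpleT i) * f) - xpow (mu ∘ simpleT i) * f)
    rw [mul_sub, sub_mul_piOp hD, sOp_mul, sOp_xpow, comp_simpleT_comp_simpleT]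
    linear_combination xpow mu * sub_mul_piOp hD i f + f * low_mul_xpow i h
  rw [mul_assoc, key, mul_sub, ← mul_assoc, piEnd_mul_self, sub_self]

lemma piOp_xpow_of_neg (hD : IsDividedDiff D) (i : Idx n) {mu : Fin n → ℕ}
    (h : mu (idxHigh i) = mu (idxLow i) + 1) : piOp D i (xpow mu) = 0 := by
  apply mul_left_cancel₀ (low_sub_high_ne_zero i)
  rw [sub_mul_piOp hD, sOp_xpow, low_mul_xpow i h]
  ring

/-- `Reach hD mu₀ m A mu`: the term `A * x^mu`, with `A` a product of `m` operators `π_i`, arises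
when `x^mu₀ * π_w` is expanded by moving monomials to the right. -/
inductive Reach (hD : IsDividedDiff D) (mu₀ : Fin n → ℕ) :
    ℕ → AddMonoid.End (MvPolynomial (Fin n) ℤ) → (Fin n → ℕ) → Prop
  | base : Reach hD mu₀ 0 1 mu₀
  | fixed {m A mu} (i : Idx n) : Reach hD mu₀ m A mu → mu (idxLow i) = mu (idxHigh i) →
      Reach hD mu₀ (m + 1) (A * piEnd hD i) mu
  | pos {m A mu} (i : Idx n) : Reach hD mu₀ m A mu → mu (idxHigh i) < mu (idxLow i) →
      Reach hD mu₀ (m + 1) (A * piEnd hD i) (mu ∘ simpleT i)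

variable {hD : IsDividedDiff D} {mu₀ : Fin n → ℕ}

lemma Reach.le_one (h₀ : ∀ k, mu₀ k ≤ 1) {m : ℕ} {A : AddMonoid.End (MvPolynomial (Fin n) ℤ)}
    {mu : Fin n → ℕ} (h : Reach hD mu₀ m A mu) (k : Fin n) : mu k ≤ 1 := by
  induction h generalizing k with
  | base => exact h₀ k
  | fixed i _ _ ih => exact ih k
  | pos i _ _ ih => exact ih _

lemma Reach.exists_piWord {m : ℕ} {A : AddMonoid.End (MvPolynomial (Fin n) ℤ)}
    {mu : Fin n → ℕ} (h : Reach hD mu₀ m A mu) : ∃ w, ∀ f, A f = piWord D w f := by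
  have append : ∀ (w : List (Idx n)) i f, piWord D (w ++ [i]) f = piWord D w (piOp D i f) := by
    intro w i f
    induction w with
    | nil => rfl
    | cons j w ih => exact congrArg (piOp D j) ih
  induction h with
  | base => exact ⟨[], fun _ => rfl⟩
  | fixed i _ _ ih =>
    obtain ⟨w, hw⟩ := ih
    exact ⟨w ++ [i], fun f => by rw [append, ← hw]; rfl⟩
  | pos i _ _ ih =>
    obtain ⟨w, hw⟩ := ih
    exact ⟨w ++ [i], fun f => by rw [append, ← hw]; rfl⟩

lemma eq_or_adjacent_or_far (i j : Idx n) :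
    i = j ∨ (i.1 + 1 = j.1 ∨ j.1 + 1 = i.1) ∨ Far i j := by
  simp only [Far, Subtype.ext_iff]; omega

lemma comp_simpleT_eq_of_fixed {i : Idx n} {mu : Fin n → ℕ}
    (h : mu (idxLow i) = mu (idxHigh i)) : mu ∘ simpleT i = mu := by
  funext k
  by_cases h₁ : k = idxLow i
  · subst h₁; simp [h]
  by_cases h₂ : k = idxHigh i
  · subst h₂; simp [h]
  simp [simpleT_of_ne, h₁, h₂]

/-- Every ascent `j` of the exponent of a reachable term is cancelled by a final factor `π_j`. -/
lemma Reach.exists_factor (h₀ : ∀ k, mu₀ k ≤ 1) (hanti : Antitone mu₀) (m : ℕ) :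
    ∀ {A : AddMonoid.End (MvPolynomial (Fin n) ℤ)} {mu : Fin n → ℕ}, Reach hD mu₀ m A mu →
      ∀ j : Idx n, mu (idxLow j) < mu (idxHigh j) →
        ∃ m' < m, ∃ B, Reach hD mu₀ m' B (mu ∘ simpleT j) ∧ A = B * piEnd hD j := by
  induction m using Nat.strong_induction_on with
  | _ m IH =>
  intro A mu h j hj
  cases h with
  | base =>
    have : idxLow j ≤ idxHigh j := by simp [idxLow, idxHigh]
    exact absurd (hanti this) (not_le.mpr hj)
  | @fixed m A' _ i h hi =>
    rcases eq_or_adjacent_or_far i j with rfl | hadj | hfar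
    · omega
    · obtain ⟨m₁, hm₁, B₁, hB₁, rfl⟩ := IH m (by omega) h j hj
      have hi' : (mu ∘ simpleT j) (idxLow i) < (mu ∘ simpleT j) (idxHigh i) ∧
          (mu ∘ simpleT j ∘ simpleT i) (idxLow j) = (mu ∘ simpleT j ∘ simpleT i) (idxHigh j) := by
        rcases hadj with hadj | hadj
        · have hb : idxLow j = idxHigh i := by simp [idxLow, idxHigh, hadj]
          have h₁ : simpleT j (idxLow i) = idxLow i := by
            apply simpleT_of_ne <;> simp only [idxLow, idxHigh, ne_eq, Fin.mk.injEq] <;> omega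
          have h₂ : simpleT i (idxHigh j) = idxHigh j := by
            apply simpleT_of_ne <;> simp only [idxLow, idxHigh, ne_eq, Fin.mk.injEq] <;> omega
          have h₃ : simpleT j (idxHigh i) = idxHigh j := by rw [← hb, simpleT_low]
          have h₄ : simpleT i (idxLow j) = idxLow i := by rw [hb, simpleT_high]
          rw [hb] at hj
          simp only [Function.comp_apply, h₁, h₂, h₃, h₄, simpleT_high]
          rw [hb]
          omega
        · have hb : idxLow i = idxHigh j := by simp [idxLow, idxHigh, hadj]
          have h₁ : simpleT j (idxHigh i) = idxHigh i := by
            apply simpleT_of_ne <;> simp only [idxLow, idxHigh, ne_eq, Fin.mk.injEq] <;> omega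
          have h₂ : simpleT i (idxLow j) = idxLow j := by
            apply simpleT_of_ne <;> simp only [idxLow, idxHigh, ne_eq, Fin.mk.injEq] <;> omega
          have h₃ : simpleT j (idxLow i) = idxLow j := by rw [hb, simpleT_high]
          have h₄ : simpleT i (idxHigh j) = idxHigh i := by rw [← hb, simpleT_low]
          rw [hb] at hi
          simp only [Function.comp_apply, h₁, h₂, h₃, h₄, simpleT_low]
          omega
      obtain ⟨m₂, hm₂, B₂, hB₂, rfl⟩ := IH m₁ (by omega) hB₁ i hi'.1
      refine ⟨m₂ + 1 + 1, by omega, B₂ * piEnd hD j * piEnd hD i, ?_, ?_⟩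
      · have := (hB₂.fixed j hi'.2).pos i (by simpa using hi'.1)
        rwa [comp_simpleT_comp_simpleT] at this
      · simp only [mul_assoc]
        rw [← mul_assoc (piEnd hD i), piEnd_braid hD hadj, mul_assoc]
    · obtain ⟨m', hm', B, hB, rfl⟩ := IH m (by omega) h j hj
      refine ⟨m' + 1, by omega, B * piEnd hD i, hB.fixed i ?_, ?_⟩
      · simpa [hfar.symm.simpleT_low, hfar.symm.simpleT_high] using hi
      · rw [mul_assoc, mul_assoc, piEnd_comm hD hfar]
  | @pos m A' mu i h hi =>
    rcases eq_or_adjacent_or_far i j with rfl | hadj | hfar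
    · exact ⟨m, by omega, A', by rwa [comp_simpleT_comp_simpleT], rfl⟩
    · exfalso
      have hi' : (mu ∘ simpleT i) (idxLow i) < (mu ∘ simpleT i) (idxHigh i) := by simpa using hi
      have hle := fun k => h.le_one h₀ (simpleT i k)
      simp only [Function.comp_apply] at hi' hj
      have h₁ := hle (idxHigh i)
      have h₂ := hle (idxHigh j)
      rcases hadj with hadj | hadj
      · have hb : idxLow j = idxHigh i := by simp [idxLow, idxHigh, hadj]
        rw [hb] at hj
        omega
      · have hb : idxLow i = idxHigh j := by simp [idxLow, idxHigh, hadj]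
        rw [hb] at hi'
        omega
    · simp only [Function.comp_apply, hfar.simpleT_low, hfar.simpleT_high] at hj
      obtain ⟨m', hm', B, hB, rfl⟩ := IH m (by omega) h j hj
      refine ⟨m' + 1, by omega, B * piEnd hD i, ?_, ?_⟩
      · have := hB.pos i
          (by simpa [hfar.symm.simpleT_low, hfar.symm.simpleT_high] using hi)
        rwa [Function.comp_assoc, ← hfar.simpleT_comm, ← Function.comp_assoc] at this
      · rw [mul_assoc, mul_assoc, piEnd_comm hD hfar]

/-- Sums of reachable terms, viewed as operators. -/
noncomputable def reachSums (hD : IsDividedDiff D) (mu₀ : Fin n → ℕ) :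
    AddSubmonoid (AddMonoid.End (MvPolynomial (Fin n) ℤ)) :=
  AddSubmonoid.closure {T | ∃ m A mu, Reach hD mu₀ m A mu ∧ T = A * mulEnd mu}

lemma mul_piEnd_mem_reachSums (h₀ : ∀ k, mu₀ k ≤ 1) (hanti : Antitone mu₀) (i : Idx n)
    {T : AddMonoid.End (MvPolynomial (Fin n) ℤ)} (hT : T ∈ reachSums hD mu₀) :
    T * piEnd hD i ∈ reachSums hD mu₀ := by
  induction hT using AddSubmonoid.closure_induction with
  | zero => rw [zero_mul]; exact zero_mem _
  | add S T _ _ hS hT => rw [add_mul]; exact add_mem hS hT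
  | mem T hT =>
    obtain ⟨m, A, mu, h, rfl⟩ := hT
    have hl := h.le_one h₀ (idxLow i)
    have hh := h.le_one h₀ (idxHigh i)
    rcases lt_trichotomy (mu (idxLow i)) (mu (idxHigh i)) with hlt | heq | hgt
    · obtain ⟨m', _, B, _, rfl⟩ := h.exists_factor h₀ hanti m i hlt
      rw [mul_assoc, mul_assoc, ← mul_assoc (piEnd hD i),
        piEnd_mul_mulEnd_mul_piEnd_of_neg hD i (by omega), mul_zero]
      exact zero_mem _
    · rw [mul_assoc, mulEnd_mul_piEnd_of_eq hD i (comp_simpleT_eq_of_fixed heq), ← mul_assoc]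
      exact AddSubmonoid.subset_closure ⟨_, _, _, h.fixed i heq, rfl⟩
    · rw [mul_assoc, mulEnd_mul_piEnd_of_pos hD i (by omega), mul_add, ← mul_assoc]
      exact add_mem (AddSubmonoid.subset_closure ⟨_, _, _, h.pos i hgt, rfl⟩)
        (AddSubmonoid.subset_closure ⟨_, _, _, h, rfl⟩)

lemma mulEnd_mul_prod_mem_reachSums (h₀ : ∀ k, mu₀ k ≤ 1) (hanti : Antitone mu₀)
    (w : List (Idx n)) : mulEnd mu₀ * (w.map (piEnd hD)).prod ∈ reachSums hD mu₀ := by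
  induction w using List.reverseRecOn with
  | nil => exact AddSubmonoid.subset_closure ⟨_, _, _, Reach.base, by simp⟩
  | append_singleton w i ih =>
    rw [List.map_append, List.prod_append, List.map_singleton, List.prod_singleton, ← mul_assoc]
    exact mul_piEnd_mem_reachSums h₀ hanti i ih

lemma prod_piEnd_apply (hD : IsDividedDiff D) (w : List (Idx n)) (f : MvPolynomial (Fin n) ℤ) :
    (w.map (piEnd hD)).prod f = piWord D w f := by
  induction w with
  | nil => rfl
  | cons i w ih =>
    rw [List.map_cons, List.prod_cons]
    exact congrArg (piOp D i) ih

lemma antitone_of_forall_idx {mu : Fin n → ℕ}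
    (h : ∀ i : Idx n, mu (idxHigh i) ≤ mu (idxLow i)) : Antitone mu := by
  have key : ∀ (d a : ℕ) (ha : a + d < n), mu ⟨a + d, ha⟩ ≤ mu ⟨a, by omega⟩ := by
    intro d
    induction d with
    | zero => intro a ha; exact le_rfl
    | succ d ih => intro a ha; exact (h ⟨a + d, ha⟩).trans (ih a (by omega))
  intro a b hab
  obtain ⟨d, hd⟩ := Nat.exists_eq_add_of_le (Fin.le_def.mp hab)
  have := key d a (hd ▸ b.2)
  simpa only [← hd] using this

lemma keyPos_of_mem_reachSums (h₀ : ∀ k, mu₀ k ≤ 1) (hanti : Antitone mu₀) {nu : Fin n → ℕ}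
    (hnu : Antitone nu) {T : AddMonoid.End (MvPolynomial (Fin n) ℤ)}
    (hT : T ∈ reachSums hD mu₀) : KeyPos D (T (xpow nu)) := by
  induction hT using AddSubmonoid.closure_induction with
  | zero => exact zero_mem _
  | add S T _ _ hS hT => exact add_mem hS hT
  | mem T hT =>
    obtain ⟨m, A, mu, h, rfl⟩ := hT
    change KeyPos D (A (xpow mu * xpow nu))
    rw [← xpow_add]
    by_cases hs : ∀ i : Idx n, (mu + nu) (idxHigh i) ≤ (mu + nu) (idxLow i)
    · obtain ⟨w, hw⟩ := h.exists_piWord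
      exact AddSubmonoid.subset_closure ⟨w, mu + nu, antitone_of_forall_idx hs, hw _⟩
    · push Not at hs
      obtain ⟨i, hi⟩ := hs
      have hle : nu (idxHigh i) ≤ nu (idxLow i) := hnu (by simp [idxLow, idxHigh])
      have hh := h.le_one h₀ (idxHigh i)
      simp only [Pi.add_apply] at hi
      obtain ⟨m', _, B, _, rfl⟩ := h.exists_factor h₀ hanti m i (by omega)
      change KeyPos D (B (piOp D i (xpow (mu + nu))))
      rw [piOp_xpow_of_neg hD i (by simp only [Pi.add_apply]; omega), map_zero]
      exact zero_mem _

end Expansion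

lemma KeyPos.xpow_mul_of_le_one {D : DD n} (hD : IsDividedDiff D) {mu : Fin n → ℕ}
    (h₀ : ∀ k, mu k ≤ 1) (hanti : Antitone mu) {f : MvPolynomial (Fin n) ℤ}
    (hf : KeyPos D f) : KeyPos D (xpow mu * f) := by
  induction hf using AddSubmonoid.closure_induction with
  | zero => rw [mul_zero]; exact zero_mem _
  | add f g _ _ hf hg => rw [mul_add]; exact add_mem hf hg
  | mem f hf =>
    obtain ⟨w, nu, hnu, rfl⟩ := hf
    have := keyPos_of_mem_reachSums h₀ hanti hnu
      (mulEnd_mul_prod_mem_reachSums (hD := hD) h₀ hanti w)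
    change KeyPos D (xpow mu * (w.map (piEnd hD)).prod (xpow nu)) at this
    rwa [prod_piEnd_apply] at this

lemma KeyPos.xpow_mul {D : DD n} (hD : IsDividedDiff D) {f : MvPolynomial (Fin n) ℤ}
    (hf : KeyPos D f) (N : ℕ) : ∀ {lam : Fin n → ℕ}, Antitone lam → (∀ k, lam k ≤ N) →
      KeyPos D (xpow lam * f) := by
  induction N with
  | zero =>
    intro lam _ hN
    have : xpow lam = 1 := by simp [xpow, fun k => Nat.le_zero.mp (hN k)]
    rwa [this, one_mul]
  | succ N ih =>
    intro lam hlam hN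
    have hsplit : lam = (fun k => min (lam k) 1) + fun k => lam k - 1 := by
      funext k; simp only [Pi.add_apply]; omega
    rw [hsplit, xpow_add, mul_assoc]
    refine KeyPos.xpow_mul_of_le_one hD (fun k => min_le_right _ _)
      (fun a b hab => min_le_min_right _ (hlam hab)) (ih (fun a b hab => ?_) fun k => ?_)
    · exact Nat.sub_le_sub_right (hlam hab) 1
    · have := hN k; omega

end KeyProduct

/-- the product of a dominating monomial and a key polynomial is
key-positive. -/
theorem stmt17 (n : ℕ) (D : DD n) (hD : IsDividedDiff D)
    (lam nu : Fin n → ℕ) (hlam : Antitone lam) (hnu : Antitone nu)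
    (w : List (Idx n)) :
    KeyPos D (xpow lam * piWord D w (xpow nu)) := by
  refine KeyProduct.KeyPos.xpow_mul hD (AddSubmonoid.subset_closure ⟨w, nu, hnu, rfl⟩)
    (∑ k, lam k) hlam fun k => Finset.single_le_sum (fun _ _ => Nat.zero_le _) (Finset.mem_univ k)
end

section
/- Let m, n, k, l be natural numbers with m ≥ n and k ≥ l. In R = MvPolynomial (Fin 3) ℤ with variables x1, x2, x3, the following identity holds: π_1(x1^m x2^n) * π_2(x1^k x2^l) = Σ_{s=0}^{min(m−n, k)} Σ_{t = max(0, s−(k−l))}^{min(l, s+n)} x1^{m+k−s} x2^{n+l+s−t} x3^t + (if m − n > k − l then Σ_{t=0}^{min(l, (m−n)−(k−l))} θ_1(x1^{m+l−t} x2^{k+n} x3^t) else 0) + (if l > n then Σ_{s=0}^{min(l−n, m−n)} θ_2(x1^{m+k−s} x2^l x3^{n+s}) else 0). -/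
open MvPolynomial

theorem sub_mul_sum_pow_mul_pow {R : Type*} [CommRing R] (x y : R) (b d : ℕ) :
    (x - y) * ∑ j ∈ Finset.range d, x ^ (b + d - 1 - j) * y ^ (b + j) =
      x ^ (b + d) * y ^ b - x ^ b * y ^ (b + d) := by
  induction d with
  | zero => simp
  | succ d ih =>
    have h : ∑ j ∈ Finset.range d, x ^ (b + (d + 1) - 1 - j) * y ^ (b + j) =
        x * ∑ j ∈ Finset.range d, x ^ (b + d - 1 - j) * y ^ (b + j) := by
      rw [Finset.mul_sum]
      refine Finset.sum_congr rfl fun j hj => ?_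
      have hj := Finset.mem_range.mp hj
      rw [← mul_assoc, ← pow_succ']
      congr 2
      omega
    rw [Finset.sum_range_succ, h, mul_add, mul_left_comm, ih,
      show b + (d + 1) - 1 - d = b by omega]
    ring

/-- The divided difference in `i`, `j` of a monomial that is dominant in these variables. -/
theorem dividedDifference_monomial {σ R : Type*} [DecidableEq σ] [CommRing R] [IsDomain R]
    {i j r : σ} (hij : i ≠ j) (hri : r ≠ i) (hrj : r ≠ j)
    {D : MvPolynomial σ R → MvPolynomial σ R}
    (hD : ∀ f, (X i - X j) * D f = f - rename ⇑(Equiv.swap i j) f)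
    {a b : ℕ} (c : ℕ) (hab : b ≤ a) :
    D (X i ^ a * X j ^ b * X r ^ c) =
      ∑ t ∈ Finset.range (a - b), X i ^ (a - 1 - t) * X j ^ (b + t) * X r ^ c := by
  have hne : (X i - X j : MvPolynomial σ R) ≠ 0 := sub_ne_zero.mpr fun h => hij (X_injective h)
  obtain ⟨d, rfl⟩ := Nat.exists_eq_add_of_le hab
  apply mul_left_cancel₀ hne
  rw [hD, ← Finset.sum_mul, Nat.add_sub_cancel_left, ← mul_assoc, sub_mul_sum_pow_mul_pow]
  simp only [map_mul, map_pow, rename_X, Equiv.swap_apply_left, Equiv.swap_apply_right,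
    Equiv.swap_apply_of_ne_of_ne hri hrj]
  ring

/-- A rectangle of lattice points is cut by two parallel diagonals into a middle strip
and two corners. -/
theorem sum_rectangle_eq_strip_add_corners {M : Type*} [AddCommMonoid M] (w : ℕ → ℕ → M)
    {m n k l : ℕ} (hmn : n ≤ m) (hkl : l ≤ k) :
    ∑ s ∈ Finset.range (m + 1 - n), ∑ t ∈ Finset.range (l + 1), w s t =
      (∑ s ∈ Finset.Icc 0 (min (m - n) k),
        ∑ t ∈ Finset.Icc (max 0 (s - (k - l))) (min l (s + n)), w s t)
      + (if k - l < m - n then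
          ∑ t ∈ Finset.Icc 0 (min l ((m - n) - (k - l))),
            ∑ j ∈ Finset.range (m + l - t - (k + n)), w (k - l + t + 1 + j) t
        else 0)
      + (if n < l then
          ∑ s ∈ Finset.Icc 0 (min (l - n) (m - n)),
            ∑ j ∈ Finset.range (l - (n + s)), w s (n + s + 1 + j)
        else 0) := by
  set S := Finset.range (m + 1 - n) ×ˢ Finset.range (l + 1) with hS
  have strip : (∑ s ∈ Finset.Icc 0 (min (m - n) k),
      ∑ t ∈ Finset.Icc (max 0 (s - (k - l))) (min l (s + n)), w s t) =
      ∑ p ∈ S with p.1 ≤ k - l + p.2 ∧ p.2 ≤ n + p.1, w p.1 p.2 := by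
    rw [Finset.sum_sigma']
    refine Finset.sum_nbij' (fun p => (p.1, p.2)) (fun p => ⟨p.1, p.2⟩) ?_ ?_
      (fun _ _ => rfl) (fun _ _ => rfl) (fun _ _ => rfl)
    · simp only [hS, Finset.mem_sigma, Finset.mem_Icc, Finset.mem_filter, Finset.mem_product,
        Finset.mem_range]
      omega
    · simp only [hS, Finset.mem_sigma, Finset.mem_Icc, Finset.mem_filter, Finset.mem_product,
        Finset.mem_range]
      omega
  have corner₁ : (if k - l < m - n then
      ∑ t ∈ Finset.Icc 0 (min l ((m - n) - (k - l))),
        ∑ j ∈ Finset.range (m + l - t - (k + n)), w (k - l + t + 1 + j) t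
      else 0) = ∑ p ∈ S with k - l + p.2 < p.1, w p.1 p.2 := by
    split_ifs with h
    · rw [Finset.sum_sigma']
      refine Finset.sum_nbij' (fun p => (k - l + p.1 + 1 + p.2, p.1))
        (fun p => ⟨p.2, p.1 - (k - l + p.2 + 1)⟩) ?_ ?_ ?_ ?_ (fun _ _ => rfl)
      · simp only [hS, Finset.mem_sigma, Finset.mem_Icc, Finset.mem_filter, Finset.mem_product,
          Finset.mem_range]
        omega
      · simp only [hS, Finset.mem_sigma, Finset.mem_Icc, Finset.mem_filter, Finset.mem_product,
          Finset.mem_range]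
        omega
      · rintro ⟨t, j⟩ -
        simp
      · rintro ⟨s, t⟩ hp
        have hst : k - l + t < s := (Finset.mem_filter.mp hp).2
        simp only [Prod.mk.injEq, and_true]
        omega
    · refine (Finset.sum_eq_zero fun p hp => ?_).symm
      simp only [hS, Finset.mem_filter, Finset.mem_product, Finset.mem_range] at hp
      omega
  have corner₂ : (if n < l then
      ∑ s ∈ Finset.Icc 0 (min (l - n) (m - n)),
        ∑ j ∈ Finset.range (l - (n + s)), w s (n + s + 1 + j)
      else 0) = ∑ p ∈ S with n + p.1 < p.2, w p.1 p.2 := by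
    split_ifs with h
    · rw [Finset.sum_sigma']
      refine Finset.sum_nbij' (fun p => (p.1, n + p.1 + 1 + p.2))
        (fun p => ⟨p.1, p.2 - (n + p.1 + 1)⟩) ?_ ?_ ?_ ?_ (fun _ _ => rfl)
      · simp only [hS, Finset.mem_sigma, Finset.mem_Icc, Finset.mem_filter, Finset.mem_product,
          Finset.mem_range]
        omega
      · simp only [hS, Finset.mem_sigma, Finset.mem_Icc, Finset.mem_filter, Finset.mem_product,
          Finset.mem_range]
        omega
      · rintro ⟨s, j⟩ -
        simp
      · rintro ⟨s, t⟩ hp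
        have hst : n + s < t := (Finset.mem_filter.mp hp).2
        simp only [Prod.mk.injEq, true_and]
        omega
    · refine (Finset.sum_eq_zero fun p hp => ?_).symm
      simp only [hS, Finset.mem_filter, Finset.mem_product, Finset.mem_range] at hp
      omega
  rw [strip, corner₁, corner₂, ← Finset.sum_product', Finset.sum_filter, Finset.sum_filter,
    Finset.sum_filter, ← Finset.sum_add_distrib, ← Finset.sum_add_distrib]
  refine Finset.sum_congr rfl fun p _ => ?_
  rcases lt_or_ge (k - l + p.2) p.1 with h₁ | h₁
  · simp [h₁, h₁.not_ge, show ¬ n + p.1 < p.2 by omega]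
  · rcases lt_or_ge (n + p.1) p.2 with h₂ | h₂
    · simp [h₁.not_gt, h₂, h₂.not_ge]
    · simp [h₁, h₁.not_gt, h₂, h₂.not_gt]

/-- the explicit atom-positive expansion of `π₁(x₁^m x₂^n) * π₂(x₁^k x₂^l)`
in `ℤ[x₁, x₂, x₃]`, where `x₁ = X 0`, `x₂ = X 1`, `x₃ = X 2`, the divided difference
operators `∂₁ = D1`, `∂₂ = D2` are characterized by
`(x_i − x_{i+1}) * ∂_i f = f − s_i f`, `π_i f = ∂_i (x_i * f)` and `θ_i f = x_{i+1} * ∂_i f`. -/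
theorem stmt19 (D1 D2 : MvPolynomial (Fin 3) ℤ → MvPolynomial (Fin 3) ℤ)
    (hD1 : ∀ f : MvPolynomial (Fin 3) ℤ,
      (X 0 - X 1) * D1 f = f - rename ⇑(Equiv.swap (0 : Fin 3) 1) f)
    (hD2 : ∀ f : MvPolynomial (Fin 3) ℤ,
      (X 1 - X 2) * D2 f = f - rename ⇑(Equiv.swap (1 : Fin 3) 2) f)
    (m n k l : ℕ) (hmn : n ≤ m) (hkl : l ≤ k) :
    D1 (X 0 * (X 0 ^ m * X 1 ^ n)) * D2 (X 1 * (X 0 ^ k * X 1 ^ l)) =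
      (∑ s ∈ Finset.Icc 0 (min (m - n) k),
        ∑ t ∈ Finset.Icc (max 0 (s - (k - l))) (min l (s + n)),
          X 0 ^ (m + k - s) * X 1 ^ (n + l + s - t) * X 2 ^ t)
      + (if k - l < m - n then
          ∑ t ∈ Finset.Icc 0 (min l ((m - n) - (k - l))),
            X 1 * D1 (X 0 ^ (m + l - t) * X 1 ^ (k + n) * X 2 ^ t)
        else 0)
      + (if n < l then
          ∑ s ∈ Finset.Icc 0 (min (l - n) (m - n)),
            X 2 * D2 (X 0 ^ (m + k - s) * X 1 ^ l * X 2 ^ (n + s))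
        else 0) := by
  have hD1' {a b : ℕ} (c : ℕ) (hab : b ≤ a) :=
    dividedDifference_monomial (r := 2) (by decide) (by decide) (by decide) hD1 c hab
  have hD2' {a b : ℕ} (c : ℕ) (hab : b ≤ a) :=
    dividedDifference_monomial (r := 0) (by decide) (by decide) (by decide) hD2 c hab
  have hpi1 : D1 (X 0 * (X 0 ^ m * X 1 ^ n)) =
      ∑ s ∈ Finset.range (m + 1 - n), X 0 ^ (m - s) * X 1 ^ (n + s) := by
    have h := hD1' 0 (hmn.trans m.le_succ)
    simpa only [pow_zero, mul_one, pow_succ', mul_assoc, Nat.succ_eq_add_one,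
      Nat.add_sub_cancel] using h
  have hpi2 : D2 (X 1 * (X 0 ^ k * X 1 ^ l)) =
      ∑ t ∈ Finset.range (l + 1), X 1 ^ (l - t) * X 2 ^ t * X 0 ^ k := by
    have h := hD2' k (Nat.zero_le (l + 1))
    simp only [pow_zero, mul_one, zero_add, Nat.add_sub_cancel, Nat.sub_zero] at h
    rw [← h]
    congr 1
    ring
  rw [hpi1, hpi2, Finset.sum_mul_sum]
  have hw : ∀ s ∈ Finset.range (m + 1 - n), ∀ t ∈ Finset.range (l + 1),
      (X 0 ^ (m - s) * X 1 ^ (n + s) * (X 1 ^ (l - t) * X 2 ^ t * X 0 ^ k) :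
        MvPolynomial (Fin 3) ℤ) =
      X 0 ^ (m + k - s) * X 1 ^ (n + l + s - t) * X 2 ^ t := by
    intro s hs t ht
    rw [Finset.mem_range] at hs ht
    rw [show m + k - s = (m - s) + k by omega, show n + l + s - t = (n + s) + (l - t) by omega]
    ring
  rw [Finset.sum_congr rfl fun s hs => Finset.sum_congr rfl (hw s hs),
    sum_rectangle_eq_strip_add_corners _ hmn hkl]
  congr 1
  · congr 1
    split_ifs with h
    · refine Finset.sum_congr rfl fun t ht => ?_
      rw [Finset.mem_Icc] at ht
      rw [hD1' t (by omega), Finset.mul_sum]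
      refine Finset.sum_congr rfl fun j hj => ?_
      rw [Finset.mem_range] at hj
      rw [show m + k - (k - l + t + 1 + j) = m + l - t - 1 - j by omega,
        show n + l + (k - l + t + 1 + j) - t = k + n + j + 1 by omega]
      ring
    · rfl
  · split_ifs with h
    · refine Finset.sum_congr rfl fun s hs => ?_
      rw [Finset.mem_Icc] at hs
      rw [mul_assoc (X 0 ^ _), mul_comm (X 0 ^ _), hD2' _ (by omega), Finset.mul_sum]
      refine Finset.sum_congr rfl fun j hj => ?_
      rw [Finset.mem_range] at hj
      rw [show n + l + s - (n + s + 1 + j) = l - 1 - j by omega]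
      ring
    · rfl
end
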